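/- arXiv:1602.02146 — 2 statements merged into one kernel-verified Lean document; each statement's English description precedes it below -/
import Mathlib

section
/- For every n ≥ 1, the group PL(Iⁿ) admits no Polish group topology: there is no topology on PL(Iⁿ) making it a topological group that is separable and completely metrizable. -/
/-- The group of self-homeomorphisms of a space, with `(f * g) x = f (g x)`. -/
instance Homeomorph.instGroupSelf {M : Type*} [TopologicalSpace M] : Group (Homeomorph M M) where
  mul f g := g.trans f
  one := Homeomorph.refl M
  inv := Homeomorph.symm
  mul_assoc f g h := Homeomorph.ext fun _ => rfl
  one_mul f := Homeomorph.ext fun _ => rfl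
  mul_one f := Homeomorph.ext fun _ => rfl
  inv_mul_cancel f := Homeomorph.ext fun x => f.symm_apply_apply x

/-- The unit cube `[0,1]ⁿ`. -/
abbrev Cube (n : ℕ) : Type := Set.Icc (0 : Fin n → ℝ) 1

/-- `f` is an orientation-preserving piecewise linear homeomorphism of the cube `[0,1]ⁿ`:
there is a finite family of `n`-dimensional affine simplices (convex hulls of `n + 1`
affinely independent points) with pairwise disjoint interiors whose union is `[0,1]ⁿ`,
such that on each simplex `f` agrees with an affine map of `ℝⁿ` whose linear part has
positive determinant. -/
def IsPLCubeHomeo {n : ℕ} (f : Homeomorph (Cube n) (Cube n)) : Prop :=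
  ∃ (k : ℕ) (p : Fin k → Fin (n + 1) → Fin n → ℝ)
    (A : Fin k → ((Fin n → ℝ) →ᵃ[ℝ] (Fin n → ℝ))),
      (∀ i, AffineIndependent ℝ (p i)) ∧
      (∀ i j, i ≠ j →
        interior (convexHull ℝ (Set.range (p i))) ∩
          interior (convexHull ℝ (Set.range (p j))) = ∅) ∧
      (⋃ i, convexHull ℝ (Set.range (p i))) = Set.Icc (0 : Fin n → ℝ) 1 ∧
      (∀ i, 0 < LinearMap.det (A i).linear) ∧
      (∀ i, ∀ x : Cube n, (x : Fin n → ℝ) ∈ convexHull ℝ (Set.range (p i)) →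
        (f x : Fin n → ℝ) = A i (x : Fin n → ℝ))

open Set Filter Topology

/-- A Baire separable topological group cannot be covered by countably many sets with the Baire
property each of which has uncountably many pairwise disjoint right translates. -/
theorem exists_countable_of_pairwiseDisjoint_translates {G ι κ : Type*} [Group G]
    [TopologicalSpace G] [IsTopologicalGroup G] [BaireSpace G]
    [TopologicalSpace.SeparableSpace G] [Countable ι]
    (B : ι → Set G) (hB : ∀ i, BaireMeasurableSet (B i)) (hcov : ⋃ i, B i = univ)
    (S : ι → Set κ) (h : ι → κ → G)
    (hdisj : ∀ i, ∀ a ∈ S i, ∀ b ∈ S i, a ≠ b → ∀ f, f * h i a ∈ B i → f * h i b ∉ B i) :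
    ∃ i, (S i).Countable := by
  choose O hO hBO using fun i => (hB i).residualEq_isOpen
  have hne : ∃ i, (O i).Nonempty := by
    by_contra! hempty
    have hres : ∀ i, (B i)ᶜ ∈ residual G := fun i => by
      filter_upwards [(hBO i).mem_iff] with x hx hxB
      simpa [hempty i] using hx.1 hxB
    have := dense_of_mem_residual (countable_iInter_mem.2 hres)
    rw [← compl_iUnion, hcov, compl_univ] at this
    simpa using this.nonempty
  obtain ⟨i, hi⟩ := hne
  refine ⟨i, ?_⟩
  have hpd : (S i).PairwiseDisjoint fun a => (fun f : G => f * h i a) ⁻¹' O i := by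
    intro a ha b hb hab
    rw [Function.onFun, Set.disjoint_iff_inter_eq_empty]
    by_contra hnon
    have hopen : IsOpen (((fun f : G => f * h i a) ⁻¹' O i) ∩ ((fun f : G => f * h i b) ⁻¹' O i)) :=
      ((hO i).preimage (continuous_mul_const _)).inter ((hO i).preimage (continuous_mul_const _))
    have key : ∀ c, ∀ᶠ f in residual G, (f * h i c ∈ B i ↔ f * h i c ∈ O i) := fun c =>
      (tendsto_residual_of_isOpenMap (continuous_mul_const (h i c))
        (isOpenMap_mul_right (h i c))).eventually (hBO i).mem_iff
    have hd := dense_of_mem_residual ((key a).and (key b))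
    obtain ⟨f, hf, hfa, hfb⟩ := hd.inter_open_nonempty _ hopen (nonempty_iff_ne_empty.2 hnon)
    exact hdisj i a ha b hb hab f (hfa.2 hf.1) (hfb.2 hf.2)
  refine hpd.countable_of_isOpen (fun a _ => (hO i).preimage (continuous_mul_const _)) ?_
  rintro a -
  obtain ⟨x, hx⟩ := hi
  exact ⟨x * (h i a)⁻¹, by simpa using hx⟩

section Kuhn

variable {n M : ℕ}

/-- The vertices of the simplex of the Kuhn triangulation of mesh `1 / M` given by a cell `c` and an
ordering `τ` of the coordinates. -/
noncomputable def kuhnVertex (c : Fin n → Fin M) (τ : Equiv.Perm (Fin n)) (j : Fin (n + 1)) :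
    Fin n → ℝ :=
  fun i => (((c i : ℕ) : ℝ) + if (τ i : ℕ) < j then 1 else 0) / M

/-- The simplex of the Kuhn triangulation given by a cell `c` and an ordering `τ`, described by
inequalities. -/
def kuhnSimplex (c : Fin n → Fin M) (τ : Equiv.Perm (Fin n)) : Set (Fin n → ℝ) :=
  {x | ∀ i, 0 ≤ M * x i - (c i : ℕ) ∧ M * x i - (c i : ℕ) ≤ 1 ∧
    ∀ j, τ i ≤ τ j → M * x j - (c j : ℕ) ≤ M * x i - (c i : ℕ)}

theorem convex_kuhnSimplex (c : Fin n → Fin M) (τ : Equiv.Perm (Fin n)) :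
    Convex ℝ (kuhnSimplex c τ) := by
  intro x hx y hy s t hs ht hst i
  obtain ⟨hx0, hx1, hxj⟩ := hx i
  obtain ⟨hy0, hy1, hyj⟩ := hy i
  have e : ∀ k, (M : ℝ) * (s • x + t • y) k - (c k : ℕ)
      = s * (M * x k - (c k : ℕ)) + t * (M * y k - (c k : ℕ)) := fun k => by
    simp only [Pi.add_apply, Pi.smul_apply, smul_eq_mul]
    linear_combination ((c k : ℕ) : ℝ) * hst
  refine ⟨?_, ?_, fun j hij => ?_⟩
  · rw [e]; positivity
  · rw [e, ← hst]; nlinarith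
  · rw [e, e]
    exact add_le_add (mul_le_mul_of_nonneg_left (hxj j hij) hs)
      (mul_le_mul_of_nonneg_left (hyj j hij) ht)

theorem kuhnVertex_mem_kuhnSimplex (hM : 0 < M) (c : Fin n → Fin M) (τ : Equiv.Perm (Fin n))
    (j : Fin (n + 1)) : kuhnVertex c τ j ∈ kuhnSimplex c τ := by
  have hM' : (M : ℝ) ≠ 0 := by positivity
  have e : ∀ k, (M : ℝ) * kuhnVertex c τ j k - (c k : ℕ) = if (τ k : ℕ) < j then 1 else 0 :=
    fun k => by rw [kuhnVertex, mul_div_cancel₀ _ hM']; ring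
  intro i
  simp only [e]
  refine ⟨by split_ifs <;> norm_num, by split_ifs <;> norm_num, fun k hk => ?_⟩
  have : (τ i : ℕ) ≤ τ k := hk
  split_ifs <;> first | omega | norm_num

theorem sum_range_sub_mul_ite (Z : ℕ → ℝ) (r : ℕ) {N : ℕ} (h : r + 1 ≤ N) :
    ∑ j ∈ Finset.range N, (Z j - Z (j + 1)) * (if r < j then 1 else 0) = Z (r + 1) - Z N := by
  induction N, h using Nat.le_induction with
  | base =>
    rw [sub_self]
    refine Finset.sum_eq_zero fun j hj => ?_
    rw [if_neg (by have := Finset.mem_range.1 hj; omega), mul_zero]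
  | succ N hN ih =>
    rw [Finset.sum_range_succ, ih, if_pos (by omega)]
    ring

theorem convexHull_kuhnVertex (hM : 0 < M) (c : Fin n → Fin M) (τ : Equiv.Perm (Fin n)) :
    convexHull ℝ (range (kuhnVertex c τ)) = kuhnSimplex c τ := by
  refine Subset.antisymm (convexHull_min (range_subset_iff.2 fun j =>
    kuhnVertex_mem_kuhnSimplex hM c τ j) (convex_kuhnSimplex c τ)) fun x hx => ?_
  have hM' : (M : ℝ) ≠ 0 := by positivity
  set z : Fin n → ℝ := fun i => M * x i - (c i : ℕ) with hz
  set Z : ℕ → ℝ := fun k => if k = 0 then 1 else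
    if h : k - 1 < n then z (τ.symm ⟨k - 1, h⟩) else 0 with hZ
  have hZ0 : Z 0 = 1 := by simp [hZ]
  have hZn : Z (n + 1) = 0 := by simp [hZ]
  have hZs : ∀ i, Z ((τ i : ℕ) + 1) = z i := fun i => by simp [hZ]
  have hstep : ∀ j < n + 1, Z (j + 1) ≤ Z j := by
    intro j hj
    rcases Nat.eq_zero_or_pos j with rfl | hj0
    · rw [hZ0]
      by_cases hn : 0 < n
      · have e1 : Z (0 + 1) = z (τ.symm ⟨0, hn⟩) := by simp [hZ, hn]
        rw [e1]
        exact (hx _).2.1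
      · simp [hZ, hn]
    · have hj1 : j - 1 < n := by omega
      have ej : Z j = z (τ.symm ⟨j - 1, hj1⟩) := by simp [hZ, hj0.ne', hj1]
      by_cases hjn : j < n
      · have ej' : Z (j + 1) = z (τ.symm ⟨j, hjn⟩) := by simp [hZ, hjn]
        rw [ej, ej']
        exact (hx _).2.2 _ (by simp [Fin.le_def])
      · have ej' : Z (j + 1) = 0 := by simp [hZ, hjn]
        rw [ej, ej']
        exact (hx _).1
  have hsum : ∑ j : Fin (n + 1), (Z j - Z (j + 1)) = 1 := by
    rw [Fin.sum_univ_eq_sum_range (fun j => Z j - Z (j + 1)), Finset.sum_range_sub', hZ0, hZn,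
      sub_zero]
  have hx' : x = ∑ j : Fin (n + 1), (Z j - Z (j + 1)) • kuhnVertex c τ j := by
    ext i
    have h2 := sum_range_sub_mul_ite Z (τ i : ℕ) (N := n + 1) (by omega)
    rw [← Fin.sum_univ_eq_sum_range (fun j => (Z j - Z (j + 1)) * if (τ i : ℕ) < j then 1 else 0),
      hZn, hZs, sub_zero] at h2
    simp only [Finset.sum_apply, Pi.smul_apply, smul_eq_mul, kuhnVertex]
    have h3 : ∀ j : Fin (n + 1), (Z j - Z (j + 1)) *
        ((((c i : ℕ) : ℝ) + if (τ i : ℕ) < j then 1 else 0) / M)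
        = ((Z j - Z (j + 1)) * ((c i : ℕ) : ℝ) +
          (Z j - Z (j + 1)) * (if (τ i : ℕ) < j then 1 else 0)) / M := fun j => by ring
    rw [Finset.sum_congr rfl fun j _ => h3 j, ← Finset.sum_div, Finset.sum_add_distrib,
      ← Finset.sum_mul, hsum, h2, hz]
    field_simp
    ring
  rw [hx']
  refine (convex_convexHull ℝ _).sum_mem (fun j _ => sub_nonneg.2 (hstep j j.2)) hsum
    fun j _ => subset_convexHull ℝ _ (mem_range_self j)

theorem affineIndependent_kuhnVertex (hM : 0 < M) (c : Fin n → Fin M) (τ : Equiv.Perm (Fin n)) :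
    AffineIndependent ℝ (kuhnVertex c τ) := by
  have hM' : (M : ℝ) ≠ 0 := by positivity
  rw [affineIndependent_iff_of_fintype]
  intro w hw hws
  rw [Finset.weightedVSub_eq_linear_combination Finset.univ hw] at hws
  set W : ℕ → ℝ := fun k => if h : k < n + 1 then w ⟨k, h⟩ else 0 with hW
  have hWw : ∀ j : Fin (n + 1), W j = w j := fun j => dif_pos j.is_lt
  have tail : ∀ r < n, ∑ j ∈ Finset.range (n + 1), W j * (if r < j then 1 else 0) = 0 := by
    intro r hr
    have h1 := congrFun hws (τ.symm ⟨r, hr⟩)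
    simp only [Finset.sum_apply, Pi.smul_apply, smul_eq_mul, kuhnVertex, Pi.zero_apply,
      Equiv.apply_symm_apply] at h1
    rw [← Fin.sum_univ_eq_sum_range (fun j => W j * if r < j then 1 else 0)]
    simp only [hWw]
    have h3 : ∀ j : Fin (n + 1), w j *
        ((((c (τ.symm ⟨r, hr⟩) : ℕ) : ℝ) + if r < j then 1 else 0) / M)
        = (w j * ((c (τ.symm ⟨r, hr⟩) : ℕ) : ℝ) + w j * (if r < (j : ℕ) then 1 else 0)) / M :=
      fun j => by ring
    rw [Finset.sum_congr rfl fun j _ => h3 j, ← Finset.sum_div, Finset.sum_add_distrib,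
      ← Finset.sum_mul, hw, zero_mul, zero_add, div_eq_zero_iff] at h1
    exact h1.resolve_right hM'
  have tot : ∑ j ∈ Finset.range (n + 1), W j = 0 := by
    rw [← Fin.sum_univ_eq_sum_range]; simpa only [hWw] using hw
  have head : ∀ r, r ≤ n + 1 → ∑ j ∈ Finset.range r, W j = 0 := by
    intro r hr
    rcases Nat.eq_zero_or_pos r with rfl | hr0
    · simp
    rcases Nat.lt_or_ge n r with hrn | hrn
    · rw [show r = n + 1 by omega, tot]
    have h1 := tail (r - 1) (by omega)
    rw [← Finset.sum_range_add_sum_Ico _ (show r ≤ n + 1 by omega)] at h1 tot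
    have h2 : ∑ j ∈ Finset.range r, W j * (if r - 1 < j then 1 else 0) = 0 :=
      Finset.sum_eq_zero fun j hj => by
        rw [if_neg (by have := Finset.mem_range.1 hj; omega), mul_zero]
    have h3 : ∑ j ∈ Finset.Ico r (n + 1), W j * (if r - 1 < j then 1 else 0)
        = ∑ j ∈ Finset.Ico r (n + 1), W j :=
      Finset.sum_congr rfl fun j hj => by
        rw [if_pos (by have := (Finset.mem_Ico.1 hj).1; omega), mul_one]
    rw [h2, h3] at h1
    linarith
  intro j
  have h1 := head (j + 1) (by omega)
  rw [Finset.sum_range_succ, head j (by omega), zero_add, hWw] at h1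
  exact h1

theorem lt_of_mem_interior_kuhnSimplex (hM : 0 < M) {c : Fin n → Fin M} {τ : Equiv.Perm (Fin n)}
    {x : Fin n → ℝ} (hx : x ∈ interior (kuhnSimplex c τ)) (i : Fin n) :
    0 < M * x i - (c i : ℕ) ∧ M * x i - (c i : ℕ) < 1 ∧
      ∀ j, τ i < τ j → M * x j - (c j : ℕ) < M * x i - (c i : ℕ) := by
  have hM' : (0 : ℝ) < M := by positivity
  have hcont : Tendsto (fun t : ℝ => x + Pi.single i t) (𝓝 0) (𝓝 x) := by
    have : Continuous fun t : ℝ => x + Pi.single i t :=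
      continuous_const.add (continuous_single (A := fun _ => ℝ) i)
    simpa using this.tendsto 0
  have hev := hcont.eventually (mem_interior_iff_mem_nhds.1 hx)
  obtain ⟨ε, hε, hball⟩ := Metric.eventually_nhds_iff.1 hev
  have hpos : x + Pi.single i (ε / 2) ∈ kuhnSimplex c τ :=
    hball (by rw [Real.dist_eq, sub_zero, abs_of_pos] <;> linarith)
  have hneg : x + Pi.single i (-(ε / 2)) ∈ kuhnSimplex c τ :=
    hball (by rw [Real.dist_eq, sub_zero, abs_neg, abs_of_pos] <;> linarith)
  have hMε : 0 < M * (ε / 2) := by positivity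
  refine ⟨?_, ?_, fun j hij => ?_⟩
  · have := (hneg i).1
    simp only [Pi.add_apply, Pi.single_eq_same] at this
    linarith
  · have := (hpos i).2.1
    simp only [Pi.add_apply, Pi.single_eq_same] at this
    linarith
  · have := (hneg i).2.2 j hij.le
    have hji : j ≠ i := by rintro rfl; exact lt_irrefl _ hij
    simp only [Pi.add_apply, Pi.single_eq_same, Pi.single_eq_of_ne hji, add_zero] at this
    linarith

theorem disjoint_interior_kuhnSimplex (hM : 0 < M) {c c' : Fin n → Fin M}
    {τ τ' : Equiv.Perm (Fin n)} (h : (c, τ) ≠ (c', τ')) :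
    interior (kuhnSimplex c τ) ∩ interior (kuhnSimplex c' τ') = ∅ := by
  rw [← not_nonempty_iff_eq_empty]
  rintro ⟨x, hx, hx'⟩
  have H := lt_of_mem_interior_kuhnSimplex hM hx
  have H' := lt_of_mem_interior_kuhnSimplex hM hx'
  apply h
  have hc : c = c' := by
    ext i
    obtain ⟨h1, h2, -⟩ := H i
    obtain ⟨h3, h4, -⟩ := H' i
    have a1 : ((c i : ℕ) : ℝ) < (c' i : ℕ) + 1 := by linarith
    have a2 : ((c' i : ℕ) : ℝ) < (c i : ℕ) + 1 := by linarith
    norm_cast at a1 a2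
    omega
  subst hc
  have hlt : ∀ i j, τ i < τ j → τ' i < τ' j := by
    intro i j hij
    by_contra hcon
    rcases (not_lt.1 hcon).lt_or_eq with h1 | h1
    · exact lt_asymm ((H i).2.2 j hij) ((H' j).2.2 i h1)
    · rw [τ'.injective h1] at hij
      exact lt_irrefl _ hij
  have hmono : StrictMono (τ' ∘ τ.symm) := fun a b hab => hlt _ _ (by simpa using hab)
  have hid : ∀ a, (τ' ∘ τ.symm) a = a := fun a =>
    congrFun (congrArg DFunLike.coe (Subsingleton.elim
      (hmono.orderIsoOfSurjective _ (τ'.surjective.comp τ.symm.surjective)) (OrderIso.refl _))) a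
  congr 1
  ext i : 1
  simpa using (hid (τ i)).symm

theorem iUnion_kuhnSimplex (hM : 0 < M) :
    ⋃ q : (Fin n → Fin M) × Equiv.Perm (Fin n), kuhnSimplex q.1 q.2
      = Icc (0 : Fin n → ℝ) 1 := by
  have hM' : (0 : ℝ) < M := by positivity
  refine Subset.antisymm (iUnion_subset fun q x hx => ?_) fun x hx => ?_
  · refine ⟨fun i => ?_, fun i => ?_⟩
    · have h1 := (hx i).1
      have h2 : (0 : ℝ) ≤ (q.1 i : ℕ) := by positivity
      exact nonneg_of_mul_nonneg_right (show 0 ≤ (M : ℝ) * x i by linarith) hM'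
    · have h1 := (hx i).2.1
      have h2 : ((q.1 i : ℕ) : ℝ) + 1 ≤ M := by exact_mod_cast (q.1 i).2
      exact le_of_mul_le_mul_left (show (M : ℝ) * x i ≤ M * 1 by linarith) hM'
  · have hc : ∀ i, ∃ k : Fin M, 0 ≤ M * x i - (k : ℕ) ∧ M * x i - (k : ℕ) ≤ 1 := by
      intro i
      have h0 : 0 ≤ x i := hx.1 i
      have h1 : x i ≤ 1 := hx.2 i
      rcases h1.lt_or_eq with h1 | h1
      · have h2 : 0 ≤ (M : ℝ) * x i := by positivity
        refine ⟨⟨⌊(M : ℝ) * x i⌋₊, (Nat.floor_lt h2).2 (by nlinarith)⟩, ?_, ?_⟩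
        · simpa using Nat.floor_le h2
        · have := (Nat.lt_floor_add_one ((M : ℝ) * x i)).le
          simp only
          linarith
      · refine ⟨⟨M - 1, by omega⟩, ?_, ?_⟩ <;> simp [h1, Nat.cast_sub (show 1 ≤ M from hM)]
    choose c hc0 hc1 using hc
    set f : Fin n → ℝ := fun i => -(M * x i - (c i : ℕ)) with hf
    refine mem_iUnion.2 ⟨(c, (Tuple.sort f)⁻¹), fun i => ⟨hc0 i, hc1 i, fun j hij => ?_⟩⟩
    have := Tuple.monotone_sort f hij
    simp only [Function.comp_apply, ← Equiv.Perm.mul_apply, mul_inv_cancel,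
      Equiv.Perm.one_apply] at this
    exact neg_le_neg_iff.1 this

end Kuhn

theorem isPLCubeHomeo_of_eqOn_kuhnSimplex {n M : ℕ} (hM : 0 < M) (i₀ : Fin n)
    (b : (Fin n → ℝ) → ℝ) {K : ℝ} (hK : K < 1) (hLip : ∀ x y, |b x - b y| ≤ K * dist x y)
    (haff : ∀ (c : Fin n → Fin M) (τ : Equiv.Perm (Fin n)),
      ∃ (l : (Fin n → ℝ) →ₗ[ℝ] ℝ) (γ : ℝ), ∀ x ∈ kuhnSimplex c τ, b x = l x + γ)
    (f : Homeomorph (Cube n) (Cube n))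
    (hf : ∀ x : Cube n, (f x : Fin n → ℝ) = (x : Fin n → ℝ) + Pi.single i₀ (b x)) : IsPLCubeHomeo f := by
  have hM' : (0 : ℝ) < M := by positivity
  choose l γ hl using haff
  let e := (Fintype.equivFin ((Fin n → Fin M) × Equiv.Perm (Fin n))).symm
  let A : (Fin n → Fin M) × Equiv.Perm (Fin n) → ((Fin n → ℝ) →ᵃ[ℝ] (Fin n → ℝ)) := fun q =>
    (LinearMap.transvection (l q.1 q.2) (Pi.single i₀ 1)).toAffineMap +
      AffineMap.const ℝ (Fin n → ℝ) (Pi.single i₀ (γ q.1 q.2) : Fin n → ℝ)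
  refine ⟨_, fun i => kuhnVertex (e i).1 (e i).2, fun i => A (e i), fun i =>
    affineIndependent_kuhnVertex hM _ _, fun i j hij => ?_, ?_, fun i => ?_, fun i x hx => ?_⟩
  · rw [convexHull_kuhnVertex hM, convexHull_kuhnVertex hM]
    exact disjoint_interior_kuhnSimplex hM fun h => hij (e.injective h)
  · simp only [convexHull_kuhnVertex hM]
    rw [e.surjective.iUnion_comp fun q => kuhnSimplex q.1 q.2, iUnion_kuhnSimplex hM]
  · change 0 < LinearMap.det (A (e i)).linear
    generalize e i = q
    obtain ⟨c, τ⟩ := q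
    have hlin : (A (c, τ)).linear = LinearMap.transvection (l c τ) (Pi.single i₀ 1) := by
      simp [A]
    rw [hlin, LinearMap.transvection.det]
    set u := kuhnVertex c τ (τ i₀).castSucc with hu
    set w := kuhnVertex c τ (τ i₀).succ with hw
    have hwu : w = u + (1 / M : ℝ) • Pi.single i₀ (1 : ℝ) := by
      ext j
      rcases eq_or_ne j i₀ with rfl | hj
      · simp [hu, hw, kuhnVertex]
        ring
      · have hne : (τ j : ℕ) ≠ τ i₀ := fun h => hj (τ.injective (Fin.ext h))
        have hiff : (τ j : ℕ) < τ i₀ + 1 ↔ (τ j : ℕ) < τ i₀ := by omega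
        simp [hu, hw, kuhnVertex, hj, hiff]
    have h1 : b w - b u = l c τ (Pi.single i₀ 1) / M := by
      rw [hl c τ w (kuhnVertex_mem_kuhnSimplex hM _ _ _),
        hl c τ u (kuhnVertex_mem_kuhnSimplex hM _ _ _), hwu, map_add, map_smul, smul_eq_mul]
      ring
    have h2 : dist w u = 1 / M := by
      rw [hwu, dist_eq_norm, add_sub_cancel_left, norm_smul, Pi.norm_single]
      simp
    have h3 := hLip w u
    rw [h1, h2, abs_div, abs_of_pos hM', mul_one_div, div_le_div_iff_of_pos_right hM'] at h3
    linarith [neg_abs_le (l c τ (Pi.single i₀ 1))]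
  · rw [convexHull_kuhnVertex hM] at hx
    rw [hf, hl _ _ _ hx]
    ext j
    rcases eq_or_ne j i₀ with rfl | hj
    · simp [A, LinearMap.transvection.apply]
      ring
    · simp [A, LinearMap.transvection.apply, hj]

theorem exists_homeomorph_add_single {n : ℕ} (i₀ : Fin n)
    (b : (Fin n → ℝ) → ℝ) {K : ℝ} (hK0 : 0 ≤ K) (hK : K < 1)
    (hLip : ∀ x y, |b x - b y| ≤ K * dist x y)
    (h0 : ∀ x, x i₀ = 0 → b x = 0) (h1 : ∀ x, x i₀ = 1 → b x = 0) :
    ∃ f : Homeomorph (Cube n) (Cube n),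
      ∀ x : Cube n, (f x : Fin n → ℝ) = (x : Fin n → ℝ) + Pi.single i₀ (b x) := by
  have hcont : Continuous b := by
    refine (LipschitzWith.of_dist_le_mul (K := ⟨K, hK0⟩) fun x y => ?_).continuous
    rw [Real.dist_eq]
    exact hLip x y
  have hupd : ∀ (x : Fin n → ℝ) (s t : ℝ),
      |b (Function.update x i₀ s) - b (Function.update x i₀ t)| ≤ K * |s - t| := by
    intro x s t
    refine (hLip _ _).trans (mul_le_mul_of_nonneg_left ?_ hK0)
    refine (dist_pi_le_iff (abs_nonneg _)).2 fun j => ?_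
    rcases eq_or_ne j i₀ with rfl | hj
    · simp [Real.dist_eq]
    · simp [hj]
  have hmaps : ∀ x ∈ Icc (0 : Fin n → ℝ) 1, x + Pi.single i₀ (b x) ∈ Icc (0 : Fin n → ℝ) 1 := by
    intro x hx
    have hx0 : 0 ≤ x i₀ := hx.1 i₀
    have hx1 : x i₀ ≤ 1 := hx.2 i₀
    have e0 := hupd x (x i₀) 0
    have e1 := hupd x (x i₀) 1
    rw [h0 _ (Function.update_self ..), Function.update_eq_self, sub_zero, sub_zero,
      abs_of_nonneg hx0] at e0
    rw [h1 _ (Function.update_self ..), Function.update_eq_self, sub_zero,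
      abs_of_nonpos (by linarith : x i₀ - 1 ≤ 0)] at e1
    have e0' := abs_le.1 e0
    have e1' := abs_le.1 e1
    refine ⟨fun j => ?_, fun j => ?_⟩ <;> rcases eq_or_ne j i₀ with rfl | hj
    · simp only [Pi.zero_apply, Pi.add_apply, Pi.single_eq_same]
      nlinarith
    · simpa [hj] using hx.1 j
    · simp only [Pi.one_apply, Pi.add_apply, Pi.single_eq_same]
      nlinarith
    · simpa [hj] using hx.2 j
  let F : Cube n → Cube n := fun x => ⟨(x : Fin n → ℝ) + Pi.single i₀ (b x), hmaps x x.2⟩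
  have hFcont : Continuous F := by
    refine Continuous.subtype_mk (continuous_subtype_val.add ?_) _
    exact (continuous_single (A := fun _ => ℝ) i₀).comp (hcont.comp continuous_subtype_val)
  have hinj : Function.Injective F := by
    intro x y hxy
    have hxy' : (x : Fin n → ℝ) + Pi.single i₀ (b x) = (y : Fin n → ℝ) + Pi.single i₀ (b y) :=
      congrArg Subtype.val hxy
    have hj : ∀ j, j ≠ i₀ → (x : Fin n → ℝ) j = (y : Fin n → ℝ) j := fun j hj => by
      simpa [hj] using congrFun hxy' j
    have hi : (x : Fin n → ℝ) i₀ + b x = (y : Fin n → ℝ) i₀ + b y := by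
      simpa using congrFun hxy' i₀
    have hyx : (y : Fin n → ℝ) = Function.update (x : Fin n → ℝ) i₀ ((y : Fin n → ℝ) i₀) := by
      ext j
      rcases eq_or_ne j i₀ with rfl | hji
      · simp
      · simp [hji, hj j hji]
    have e := hupd x ((x : Fin n → ℝ) i₀) ((y : Fin n → ℝ) i₀)
    rw [← hyx, Function.update_eq_self, show b x - b y = -((x : Fin n → ℝ) i₀ - (y : Fin n → ℝ) i₀)
      by linarith, abs_neg] at e
    have hzero : |(x : Fin n → ℝ) i₀ - (y : Fin n → ℝ) i₀| = 0 := by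
      nlinarith [abs_nonneg ((x : Fin n → ℝ) i₀ - (y : Fin n → ℝ) i₀)]
    have hi0 : (x : Fin n → ℝ) i₀ = (y : Fin n → ℝ) i₀ := by
      linarith [abs_eq_zero.1 hzero]
    refine Subtype.ext ?_
    rw [hyx, ← hi0, Function.update_eq_self]
  have hsurj : Function.Surjective F := by
    intro y
    have hy0 : 0 ≤ (y : Fin n → ℝ) i₀ := y.2.1 i₀
    have hy1 : (y : Fin n → ℝ) i₀ ≤ 1 := y.2.2 i₀
    have hc : Continuous fun t : ℝ => t + b (Function.update (y : Fin n → ℝ) i₀ t) :=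
      continuous_id.add (hcont.comp (continuous_const.update i₀ continuous_id))
    obtain ⟨t, ht, hty⟩ := intermediate_value_Icc zero_le_one hc.continuousOn
      (show (y : Fin n → ℝ) i₀ ∈ _ by
        rw [h0 _ (Function.update_self ..), h1 _ (Function.update_self ..)]
        exact ⟨by linarith, by linarith⟩)
    have hmem : Function.update (y : Fin n → ℝ) i₀ t ∈ Icc (0 : Fin n → ℝ) 1 := by
      refine ⟨fun j => ?_, fun j => ?_⟩ <;> rcases eq_or_ne j i₀ with rfl | hj
      · simpa using ht.1
      · simpa [hj] using y.2.1 j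
      · simpa using ht.2
      · simpa [hj] using y.2.2 j
    refine ⟨⟨_, hmem⟩, Subtype.ext ?_⟩
    ext j
    rcases eq_or_ne j i₀ with rfl | hj
    · simpa [F] using hty
    · simp [F, hj]
  have hF' : Continuous (Equiv.ofBijective F ⟨hinj, hsurj⟩) := hFcont
  exact ⟨hF'.homeoOfEquivCompactToT2, fun x => rfl⟩

section Hat

variable {n : ℕ}

/-- The coordinates of `y` together with an extra zero coordinate. -/
def consZero (y : Fin n → ℝ) : Option (Fin n) → ℝ := fun o => o.elim 0 y

/-- The hat function of the origin for the Kuhn triangulation with integer vertices. -/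
noncomputable def kuhnHat (y : Fin n → ℝ) : ℝ :=
  max 0 (1 - (⨆ o, consZero y o) + ⨅ o, consZero y o)

theorem kuhnHat_zero : kuhnHat (0 : Fin n → ℝ) = 1 := by
  have : consZero (0 : Fin n → ℝ) = fun _ => 0 := by
    ext o
    cases o <;> rfl
  simp [kuhnHat, this]

theorem kuhnHat_eq_zero {y : Fin n → ℝ} {i : Fin n} (hi : 1 ≤ |y i|) : kuhnHat y = 0 := by
  have hle : ∀ o, consZero y o ≤ ⨆ o, consZero y o := le_ciSup (finite_range _).bddAbove
  have hge : ∀ o, ⨅ o, consZero y o ≤ consZero y o := ciInf_le (finite_range _).bddBelow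
  have h1 : 0 ≤ ⨆ o, consZero y o := hle none
  have h2 : y i ≤ ⨆ o, consZero y o := hle (some i)
  have h3 : ⨅ o, consZero y o ≤ 0 := hge none
  have h4 : ⨅ o, consZero y o ≤ y i := hge (some i)
  refine max_eq_left ?_
  rcases le_abs.1 hi with h | h <;> linarith

theorem abs_kuhnHat_sub_le (y y' : Fin n → ℝ) : |kuhnHat y - kuhnHat y'| ≤ 2 * dist y y' := by
  have hle : ∀ (y : Fin n → ℝ) o, consZero y o ≤ ⨆ o, consZero y o := fun y =>
    le_ciSup (finite_range _).bddAbove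
  have hge : ∀ (y : Fin n → ℝ) o, ⨅ o, consZero y o ≤ consZero y o := fun y =>
    ciInf_le (finite_range _).bddBelow
  have hd : ∀ (y y' : Fin n → ℝ) o, consZero y o ≤ consZero y' o + dist y y' := by
    rintro y y' (_ | i)
    · simp [consZero]
    · have := (le_abs_self _).trans ((Real.dist_eq (y i) (y' i)).symm.le.trans
        (dist_le_pi_dist y y' i))
      change y i ≤ y' i + _
      linarith
  have main : ∀ y y' : Fin n → ℝ, kuhnHat y ≤ kuhnHat y' + 2 * dist y y' := by
    intro y y'
    have h1 : ⨆ o, consZero y' o ≤ (⨆ o, consZero y o) + dist y y' :=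
      ciSup_le fun o => (hd y' y o).trans (by rw [dist_comm]; linarith [hle y o])
    have h2 : (⨅ o, consZero y o) - dist y y' ≤ ⨅ o, consZero y' o :=
      le_ciInf fun o => by linarith [hd y y' o, hge y o]
    have hnn : 0 ≤ dist y y' := dist_nonneg
    refine max_le (add_nonneg (le_max_left _ _) (by linarith)) ?_
    have := le_max_right 0 (1 - (⨆ o, consZero y' o) + ⨅ o, consZero y' o)
    change _ ≤ max 0 (1 - (⨆ o, consZero y' o) + ⨅ o, consZero y' o) + _
    linarith
  rw [abs_le]
  have h1 := main y y'
  have h2 := main y' y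
  rw [dist_comm] at h2
  constructor <;> linarith

theorem int_add_consZero_sub_of_mem_kuhnSimplex {M : ℕ} (c : Fin n → Fin M)
    (τ : Equiv.Perm (Fin n)) (k : ℤ) (o o' : Option (Fin n)) :
    (∀ x ∈ kuhnSimplex c τ, 0 ≤ (k : ℝ) + consZero (fun i => M * x i - (c i : ℕ)) o
        - consZero (fun i => M * x i - (c i : ℕ)) o') ∨
    (∀ x ∈ kuhnSimplex c τ, (k : ℝ) + consZero (fun i => M * x i - (c i : ℕ)) o
        - consZero (fun i => M * x i - (c i : ℕ)) o' ≤ 0) := by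
  have hb : ∀ x ∈ kuhnSimplex c τ, ∀ o, 0 ≤ consZero (fun i => M * x i - (c i : ℕ)) o ∧
      consZero (fun i => M * x i - (c i : ℕ)) o ≤ 1 := by
    rintro x hx (_ | i)
    · simp [consZero]
    · exact ⟨(hx i).1, (hx i).2.1⟩
  rcases lt_trichotomy k 0 with hk | rfl | hk
  · refine Or.inr fun x hx => ?_
    have hk' : (k : ℝ) ≤ -1 := by exact_mod_cast (by omega : k ≤ -1)
    linarith [hb x hx o, hb x hx o']
  · simp only [Int.cast_zero, zero_add, sub_nonneg, sub_nonpos]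
    rcases o with _ | i
    · exact Or.inr fun x hx => (hb x hx o').1
    rcases o' with _ | j
    · exact Or.inl fun x hx => (hb x hx (some i)).1
    rcases le_total (τ i) (τ j) with h | h
    · exact Or.inl fun x hx => (hx i).2.2 j h
    · exact Or.inr fun x hx => (hx j).2.2 i h
  · refine Or.inl fun x hx => ?_
    have hk' : (1 : ℝ) ≤ k := by exact_mod_cast (by omega : 1 ≤ k)
    linarith [hb x hx o, hb x hx o']

theorem exists_linear_eq_kuhnHat {M : ℕ} (v : Fin n → ℤ) (c : Fin n → Fin M)
    (τ : Equiv.Perm (Fin n)) :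
    ∃ (l : (Fin n → ℝ) →ₗ[ℝ] ℝ) (γ : ℝ), ∀ x ∈ kuhnSimplex c τ,
      kuhnHat (fun i => M * x i - v i) = l x + γ := by
  let d : Option (Fin n) → ℤ := fun o => o.elim 0 fun i => ((c i : ℕ) : ℤ) - v i
  let Y : Option (Fin n) → kuhnSimplex c τ → ℝ :=
    fun o x => consZero (fun i => M * (x : Fin n → ℝ) i - v i) o
  have hY : ∀ o x, Y o x =
      (d o : ℝ) + consZero (fun i => M * (x : Fin n → ℝ) i - (c i : ℕ)) o := by
    rintro (_ | i) x
    · simp [Y, d, consZero]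
    · simp [Y, d, consZero]
  have hcmp : ∀ o o', Y o ≤ Y o' ∨ Y o' ≤ Y o := by
    intro o o'
    rcases int_add_consZero_sub_of_mem_kuhnSimplex c τ (d o - d o') o o' with h | h
    · refine Or.inr fun x => ?_
      have := h x x.2
      push_cast at this
      rw [hY, hY]
      linarith
    · refine Or.inl fun x => ?_
      have := h x x.2
      push_cast at this
      rw [hY, hY]
      linarith
  have hdir : Directed (· ≤ ·) Y := fun o o' => (hcmp o o').elim
    (fun h => ⟨o', h, le_rfl⟩) fun h => ⟨o, le_rfl, h⟩
  have hdir' : Directed (· ≥ ·) Y := fun o o' => (hcmp o o').elim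
    (fun h => ⟨o, le_rfl, h⟩) fun h => ⟨o', h, le_rfl⟩
  obtain ⟨p, hp⟩ := hdir.finite_le id
  obtain ⟨q, hq⟩ := hdir'.finite_le id
  have hhat : ∀ x : kuhnSimplex c τ,
      kuhnHat (fun i => M * (x : Fin n → ℝ) i - v i) = max 0 (1 - Y p x + Y q x) := by
    intro x
    have h1 : ⨆ o, Y o x = Y p x :=
      le_antisymm (ciSup_le fun o => hp o x)
        (le_ciSup (f := fun o => Y o x) (finite_range _).bddAbove p)
    have h2 : ⨅ o, Y o x = Y q x :=
      le_antisymm (ciInf_le (f := fun o => Y o x) (finite_range _).bddBelow q)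
        (le_ciInf fun o => hq o x)
    rw [← h1, ← h2]
    rfl
  have hYaff : ∀ o, ∃ (l : (Fin n → ℝ) →ₗ[ℝ] ℝ) (γ : ℝ), ∀ x, Y o x = l x + γ := by
    rintro (_ | i)
    · exact ⟨0, 0, fun x => by simp [Y, consZero]⟩
    · exact ⟨(M : ℝ) • LinearMap.proj i, -(v i : ℝ), fun x => by
        simp [Y, consZero, sub_eq_add_neg]⟩
  rcases int_add_consZero_sub_of_mem_kuhnSimplex c τ (1 - d p + d q) q p with h | h
  · obtain ⟨lp, γp, hlp⟩ := hYaff p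
    obtain ⟨lq, γq, hlq⟩ := hYaff q
    refine ⟨lq - lp, 1 - γp + γq, fun x hx => ?_⟩
    have := h x hx
    push_cast at this
    rw [hhat ⟨x, hx⟩, max_eq_right (by rw [hY, hY]; linarith), hlp, hlq, LinearMap.sub_apply]
    ring
  · refine ⟨0, 0, fun x hx => ?_⟩
    have := h x hx
    push_cast at this
    rw [hhat ⟨x, hx⟩, max_eq_left (by rw [hY, hY]; linarith)]
    simp

/-- Pushing a vertex of the Kuhn triangulation along a coordinate axis is a piecewise linear
homeomorphism of the cube. -/
theorem exists_isPLCubeHomeo_kuhnHat {M : ℕ} (i₀ : Fin n) (v : Fin n → ℤ) (hv : 1 ≤ v i₀)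
    (hvM : v i₀ + 1 ≤ M) {a : ℝ} (ha : 0 < a) (haM : a < 1 / (2 * M)) :
    ∃ f : Homeomorph (Cube n) (Cube n), IsPLCubeHomeo f ∧ ∀ x : Cube n,
      (f x : Fin n → ℝ) =
        (x : Fin n → ℝ) + Pi.single i₀ (a * kuhnHat fun i => M * (x : Fin n → ℝ) i - v i) := by
  have hM : 0 < M := by omega
  have hM' : (0 : ℝ) < M := by positivity
  set b : (Fin n → ℝ) → ℝ := fun x => a * kuhnHat fun i => M * x i - v i with hb
  have hK : 2 * M * a < 1 := by
    rw [lt_div_iff₀ (by positivity)] at haM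
    linarith
  have hLip : ∀ x y, |b x - b y| ≤ 2 * M * a * dist x y := by
    intro x y
    have h1 : dist (fun i => (M : ℝ) * x i - v i) (fun i => M * y i - v i) ≤ M * dist x y := by
      refine (dist_pi_le_iff (by positivity)).2 fun i => ?_
      rw [Real.dist_eq, show (M : ℝ) * x i - v i - (M * y i - v i) = M * (x i - y i) by ring,
        abs_mul, abs_of_pos hM', ← Real.dist_eq]
      exact mul_le_mul_of_nonneg_left (dist_le_pi_dist x y i) hM'.le
    rw [hb]
    simp only
    rw [← mul_sub, abs_mul, abs_of_pos ha]
    calc a * _ ≤ a * (2 * (M * dist x y)) := mul_le_mul_of_nonneg_left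
          ((abs_kuhnHat_sub_le _ _).trans (mul_le_mul_of_nonneg_left h1 two_pos.le)) ha.le
      _ = _ := by ring
  have hv' : (1 : ℝ) ≤ v i₀ := by exact_mod_cast hv
  have hvM' : (v i₀ : ℝ) + 1 ≤ M := by exact_mod_cast hvM
  obtain ⟨f, hf⟩ := exists_homeomorph_add_single i₀ b (by positivity) hK hLip
    (fun x hx => by
      rw [hb]
      simp only
      rw [kuhnHat_eq_zero (i := i₀), mul_zero]
      rw [hx, mul_zero, zero_sub, abs_neg]
      exact hv'.trans (le_abs_self _))
    (fun x hx => by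
      rw [hb]
      simp only
      rw [kuhnHat_eq_zero (i := i₀), mul_zero]
      rw [hx, mul_one]
      exact le_trans (by linarith) (le_abs_self _))
  refine ⟨f, isPLCubeHomeo_of_eqOn_kuhnSimplex hM i₀ b hK hLip (fun c τ => ?_) f hf, hf⟩
  obtain ⟨l, γ, hl⟩ := exists_linear_eq_kuhnHat v c τ
  refine ⟨a • l, a * γ, fun x hx => ?_⟩
  rw [hb]
  simp only
  rw [hl x hx, LinearMap.smul_apply, smul_eq_mul, mul_add]

end Hat

section Cube

variable {n : ℕ}

/-- The point `w / M`, clamped to the cube. -/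
noncomputable def gridPoint (M : ℕ) (w : Fin n → ℤ) : Cube n :=
  ⟨fun i => max 0 (min 1 ((w i : ℝ) / M)),
    fun _ => le_max_left _ _, fun _ => max_le zero_le_one (min_le_left _ _)⟩

theorem gridPoint_apply {M : ℕ} {w : Fin n → ℤ} {i : Fin n} (h0 : 0 ≤ w i) (h1 : w i ≤ M) :
    (gridPoint M w : Fin n → ℝ) i = w i / M := by
  have h0' : (0 : ℝ) ≤ w i := by exact_mod_cast h0
  have h1' : (w i : ℝ) ≤ M := by exact_mod_cast h1
  change max 0 (min 1 ((w i : ℝ) / M)) = _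
  rw [min_eq_right (div_le_one_of_le₀ h1' (Nat.cast_nonneg M)),
    max_eq_right (div_nonneg h0' (Nat.cast_nonneg M))]

theorem mul_gridPoint_apply {M : ℕ} (hM : 0 < M) {w : Fin n → ℤ} {i : Fin n} (h0 : 0 ≤ w i)
    (h1 : w i ≤ M) : (M : ℝ) * (gridPoint M w : Fin n → ℝ) i = w i := by
  rw [gridPoint_apply h0 h1, mul_div_cancel₀ _ (by positivity : (M : ℝ) ≠ 0)]

/-- Every nonempty open subset of the cube contains the star of an interior lattice point of some
mesh. -/
theorem exists_lattice_star_subset {W : Set (Cube n)} (hW : IsOpen W) (hne : W.Nonempty) :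
    ∃ (M : ℕ) (v : Fin n → ℤ), 0 < M ∧ (∀ i, 1 ≤ v i ∧ v i + 1 ≤ M) ∧
      ∀ x : Cube n, (∀ i, |(M : ℝ) * (x : Fin n → ℝ) i - v i| ≤ 1) → x ∈ W := by
  obtain ⟨x, hx⟩ := hne
  obtain ⟨ε, hε, hball⟩ := Metric.isOpen_iff.1 hW x hx
  obtain ⟨M, hM⟩ := exists_nat_gt (max 2 (2 / ε))
  have hM2 : (2 : ℝ) < M := (le_max_left _ _).trans_lt hM
  have hMε : 2 / ε < M := (le_max_right _ _).trans_lt hM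
  have hM0 : (0 : ℝ) < M := by linarith
  have hM2' : 2 < M := by exact_mod_cast hM2
  have hv : ∀ i, ∃ k : ℤ, (1 ≤ k ∧ k + 1 ≤ M) ∧ |(M : ℝ) * (x : Fin n → ℝ) i - k| ≤ 1 := by
    intro i
    have h0 : 0 ≤ (x : Fin n → ℝ) i := x.2.1 i
    have h1 : (x : Fin n → ℝ) i ≤ 1 := x.2.2 i
    have hMx0 : 0 ≤ (M : ℝ) * (x : Fin n → ℝ) i := by positivity
    have hMx1 : (M : ℝ) * (x : Fin n → ℝ) i ≤ M := by nlinarith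
    rcases lt_or_ge ((M : ℝ) * (x : Fin n → ℝ) i) 1 with h | h
    · refine ⟨1, ⟨le_rfl, by omega⟩, abs_le.2 ⟨?_, ?_⟩⟩ <;> push_cast <;> linarith
    rcases lt_or_ge ((M : ℝ) * (x : Fin n → ℝ) i) (M - 1) with h' | h'
    · refine ⟨⌊(M : ℝ) * (x : Fin n → ℝ) i⌋, ⟨Int.le_floor.2 (by simpa using h), ?_⟩, ?_⟩
      · have : ⌊(M : ℝ) * (x : Fin n → ℝ) i⌋ < (M : ℤ) - 1 := Int.floor_lt.2 (by simpa using h')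
        omega
      · have h2 := Int.floor_le ((M : ℝ) * (x : Fin n → ℝ) i)
        have h3 := Int.lt_floor_add_one ((M : ℝ) * (x : Fin n → ℝ) i)
        exact abs_le.2 ⟨by linarith, by linarith⟩
    · refine ⟨M - 1, ⟨by omega, by omega⟩, abs_le.2 ⟨?_, ?_⟩⟩ <;> push_cast <;> linarith
  choose v hv1 hv2 using hv
  refine ⟨M, v, by omega, hv1, fun y hy => hball ?_⟩
  rw [Metric.mem_ball, Subtype.dist_eq]
  refine lt_of_le_of_lt ((dist_pi_le_iff (show (0 : ℝ) ≤ 2 / M by positivity)).2 fun i => ?_)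
    (by rwa [div_lt_comm₀ hM0 hε])
  rw [Real.dist_eq, le_div_iff₀ hM0]
  have h1 := abs_le.1 (hy i)
  have h2 := abs_le.1 (hv2 i)
  rw [← abs_of_pos hM0, ← abs_mul]
  exact abs_le.2 ⟨by linarith, by linarith⟩

theorem exists_isPLCubeHomeo_eqOn_compl (i₀ : Fin n) {W : Set (Cube n)} (hW : IsOpen W)
    (hne : W.Nonempty) :
    ∃ f : Homeomorph (Cube n) (Cube n), IsPLCubeHomeo f ∧ (∀ x ∉ W, f x = x) ∧
      ∃ y ∈ W, f y ≠ y := by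
  obtain ⟨M, v, hM, hv, hstar⟩ := exists_lattice_star_subset hW hne
  have hM' : (0 : ℝ) < M := by positivity
  obtain ⟨a, ha, haM⟩ := exists_between (show (0 : ℝ) < 1 / (2 * M) by positivity)
  obtain ⟨f, hf, hfx⟩ := exists_isPLCubeHomeo_kuhnHat i₀ v (hv i₀).1 (hv i₀).2 ha haM
  have hgrid : ∀ i, (M : ℝ) * (gridPoint M v : Fin n → ℝ) i - v i = 0 := fun i => by
    have := hv i
    rw [mul_gridPoint_apply hM (by omega) (by omega), sub_self]
  refine ⟨f, hf, fun x hx => ?_, gridPoint M v, hstar _ fun i => by simp [hgrid i], fun h => ?_⟩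
  · have : ∃ i, 1 ≤ |(M : ℝ) * (x : Fin n → ℝ) i - v i| := by
      by_contra! hcon
      exact hx (hstar x fun i => (hcon i).le)
    obtain ⟨i, hi⟩ := this
    refine Subtype.ext ?_
    rw [hfx, kuhnHat_eq_zero (i := i) hi]
    simp
  · have h1 := congrFun (hfx (gridPoint M v)) i₀
    rw [h, show (fun i => (M : ℝ) * (gridPoint M v : Fin n → ℝ) i - v i) = 0 from funext hgrid,
      kuhnHat_zero] at h1
    simp only [Pi.add_apply, Pi.single_eq_same, mul_one] at h1
    linarith

theorem mem_iff_of_eqOn_compl {X : Type*} {g : X → X} (hg : Function.Injective g) {W : Set X}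
    (h : ∀ x ∉ W, g x = x) (x : X) : g x ∈ W ↔ x ∈ W := by
  constructor
  · intro hx
    by_contra hxW
    exact hxW (h x hxW ▸ hx)
  · intro hx
    by_contra hgx
    exact hgx ((hg (h _ hgx)).symm ▸ hx)

theorem isOpen_setOf_exists_apply_mem (i₀ : Fin n)
    {H : Subgroup (Homeomorph (Cube n) (Cube n))}
    (hH : (H : Set (Homeomorph (Cube n) (Cube n))) = {f | IsPLCubeHomeo f})
    [TopologicalSpace H] [IsTopologicalGroup H] [T2Space H] {U W : Set (Cube n)}
    (hU : IsOpen U) (hW : IsOpen W) :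
    IsOpen {f : H | ∃ x ∈ U, (f : Homeomorph (Cube n) (Cube n)) x ∈ W} := by
  have hmem : ∀ {f}, IsPLCubeHomeo f → f ∈ H := fun {f} hf => by
    rw [← SetLike.mem_coe, hH]
    exact hf
  let S : Set (Cube n) → Set H := fun V => {h | ∀ x ∉ V, (h : Homeomorph (Cube n) (Cube n)) x = x}
  have heq : {f : H | ∃ x ∈ U, (f : Homeomorph (Cube n) (Cube n)) x ∈ W} =
      ⋃ h₁ ∈ S U, ⋃ h₂ ∈ S W, {f : H | f * h₁ * f⁻¹ * h₂ ≠ h₂ * (f * h₁ * f⁻¹)} := by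
    ext f
    simp only [mem_iUnion, mem_ofPred_eq, exists_prop]
    constructor
    · rintro ⟨x₀, hx₀U, hx₀W⟩
      obtain ⟨g₁, hg₁, hg₁U, x, hx, hg₁x⟩ := exists_isPLCubeHomeo_eqOn_compl i₀
        (hU.inter (hW.preimage (f : Homeomorph (Cube n) (Cube n)).continuous))
        ⟨x₀, hx₀U, hx₀W⟩
      let h₁ : H := ⟨g₁, hmem hg₁⟩
      let k : Homeomorph (Cube n) (Cube n) := ((f * h₁ * f⁻¹ : H) : Homeomorph (Cube n) (Cube n))
      have hk : ∀ z, k ((f : Homeomorph (Cube n) (Cube n)) z)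
          = (f : Homeomorph (Cube n) (Cube n)) (g₁ z) := fun z =>
        congrArg (fun z => (f : Homeomorph (Cube n) (Cube n)) (g₁ z))
          ((f : Homeomorph (Cube n) (Cube n)).symm_apply_apply z)
      set y := (f : Homeomorph (Cube n) (Cube n)) x with hy
      have hky : k y ≠ y := by
        rw [hk]
        exact fun h => hg₁x ((f : Homeomorph (Cube n) (Cube n)).injective h)
      obtain ⟨P, Q, hP, hQ, hyP, hyQ, hPQ⟩ := t2_separation hky
      obtain ⟨g₂, hg₂, hg₂V, z, hz, hg₂z⟩ := exists_isPLCubeHomeo_eqOn_compl i₀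
        ((hW.inter hQ).inter (hP.preimage k.continuous)) ⟨y, ⟨hx.2, hyQ⟩, hyP⟩
      refine ⟨h₁, fun w hw => hg₁U w fun h => hw h.1, ⟨g₂, hmem hg₂⟩,
        fun w hw => hg₂V w fun h => hw h.1.1, fun hcomm => ?_⟩
      have h1 : k (g₂ z) = g₂ (k z) :=
        congrArg (fun g : H => (g : Homeomorph (Cube n) (Cube n)) z) hcomm
      rw [hg₂V (k z) fun h => hPQ.le_bot ⟨hz.2, h.1.2⟩] at h1
      exact hg₂z (k.injective h1)
    · rintro ⟨h₁, hh₁, h₂, hh₂, hne⟩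
      by_contra! hcon
      apply hne
      refine Subtype.ext (Homeomorph.ext fun x => ?_)
      set k : Homeomorph (Cube n) (Cube n) :=
        ((f * h₁ * f⁻¹ : H) : Homeomorph (Cube n) (Cube n)) with hk_def
      have hk : ∀ x ∈ W, k x = x := by
        intro x hx
        have h1 : (f : Homeomorph (Cube n) (Cube n)).symm x ∉ U := fun h => hcon _ h
          (by rwa [Homeomorph.apply_symm_apply])
        change (f : Homeomorph (Cube n) (Cube n)) ((h₁ : Homeomorph (Cube n) (Cube n))
          ((f : Homeomorph (Cube n) (Cube n)).symm x)) = x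
        rw [hh₁ _ h1, Homeomorph.apply_symm_apply]
      change k ((h₂ : Homeomorph (Cube n) (Cube n)) x) = (h₂ : Homeomorph (Cube n) (Cube n)) (k x)
      by_cases hx : x ∈ W
      · rw [hk x hx, hk _ ((mem_iff_of_eqOn_compl (Homeomorph.injective _) hh₂ x).2 hx)]
      · rw [hh₂ x hx, hh₂]
        exact (mem_iff_of_eqOn_compl (W := Wᶜ) k.injective
          (fun x hx => hk x (not_not.1 hx)) x).2 hx
  rw [heq]
  refine isOpen_biUnion fun h₁ _ => isOpen_biUnion fun h₂ _ => ?_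
  exact isOpen_ne_fun (by fun_prop) (by fun_prop)

theorem measurable_apply_of_isPLCubeHomeo (i₀ : Fin n)
    {H : Subgroup (Homeomorph (Cube n) (Cube n))}
    (hH : (H : Set (Homeomorph (Cube n) (Cube n))) = {f | IsPLCubeHomeo f})
    [TopologicalSpace H] [IsTopologicalGroup H] [T2Space H] [MeasurableSpace H] [BorelSpace H]
    (x : Cube n) : Measurable fun f : H => (f : Homeomorph (Cube n) (Cube n)) x := by
  refine measurable_of_isClosed fun C hC => ?_
  have heq : (fun f : H => (f : Homeomorph (Cube n) (Cube n)) x) ⁻¹' C =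
      ⋂ m : ℕ, {f : H | ∃ u ∈ Metric.ball x (1 / (m + 1)),
        (f : Homeomorph (Cube n) (Cube n)) u ∈ Metric.thickening (1 / (m + 1)) C} := by
    ext f
    simp only [mem_iInter, mem_ofPred_eq, mem_preimage]
    constructor
    · intro hf m
      exact ⟨x, Metric.mem_ball_self Nat.one_div_pos_of_nat,
        Metric.self_subset_thickening Nat.one_div_pos_of_nat _ hf⟩
    · intro hf
      by_contra hfx
      obtain ⟨ε, hε, hball⟩ := Metric.isOpen_iff.1 hC.isOpen_compl _ hfx
      obtain ⟨δ, hδ, hfδ⟩ := Metric.continuous_iff.1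
        (f : Homeomorph (Cube n) (Cube n)).continuous x (ε / 2) (by positivity)
      obtain ⟨m, hm⟩ := exists_nat_one_div_lt (lt_min hδ (half_pos hε))
      obtain ⟨u, hu, hfu⟩ := hf m
      obtain ⟨c, hc, hcu⟩ := Metric.mem_thickening_iff.1 hfu
      refine hball ?_ hc
      rw [Metric.mem_ball, dist_comm]
      have h1 := hfδ u ((Metric.mem_ball.1 hu).trans (hm.trans_le (min_le_left _ _)))
      have h2 := hcu.trans (hm.trans_le (min_le_right _ _))
      rw [dist_comm] at h1
      linarith [dist_triangle ((f : Homeomorph (Cube n) (Cube n)) x)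
        ((f : Homeomorph (Cube n) (Cube n)) u) c]
  rw [heq]
  exact MeasurableSet.iInter fun m =>
    (isOpen_setOf_exists_apply_mem i₀ hH Metric.isOpen_ball Metric.isOpen_thickening).measurableSet

/-- A piecewise linear homeomorphism respects the midpoint of some pair of lattice points at
distance two along a given axis. -/
theorem IsPLCubeHomeo.exists_midpoint (i₀ : Fin n) {f : Homeomorph (Cube n) (Cube n)}
    (hf : IsPLCubeHomeo f) :
    ∃ (M : ℕ) (v : Fin n → ℤ), (0 < M ∧ ∀ i, 1 ≤ v i ∧ v i + 1 ≤ M) ∧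
      (f (gridPoint M v) : Fin n → ℝ) + f (gridPoint M v) =
        (f (gridPoint M (v - Pi.single i₀ 1)) : Fin n → ℝ) +
          f (gridPoint M (v + Pi.single i₀ 1)) := by
  obtain ⟨k, p, A, hp, -, hunion, -, hA⟩ := hf
  have hzero : (0 : Fin n → ℝ) ∈ ⋃ i, convexHull ℝ (range (p i)) := by
    rw [hunion]
    exact ⟨le_rfl, zero_le_one⟩
  obtain ⟨j, -⟩ := mem_iUnion.1 hzero
  have hint : (interior (convexHull ℝ (range (p j)))).Nonempty := by
    rw [interior_convexHull_nonempty_iff_affineSpan_eq_top,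
      (hp j).affineSpan_eq_top_iff_card_eq_finrank_add_one]
    simp
  obtain ⟨M, v, hM, hv, hstar⟩ := exists_lattice_star_subset
    (W := Subtype.val ⁻¹' interior (convexHull ℝ (range (p j))))
    (isOpen_interior.preimage continuous_subtype_val) (by
      obtain ⟨x, hx⟩ := hint
      have hxc : x ∈ Icc (0 : Fin n → ℝ) 1 := by
        rw [← hunion]
        exact mem_iUnion.2 ⟨j, interior_subset hx⟩
      exact ⟨⟨x, hxc⟩, hx⟩)
  refine ⟨M, v, ⟨hM, hv⟩, ?_⟩
  have hfA : ∀ w : Fin n → ℤ, (∀ i, |w i - v i| ≤ 1) →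
      (f (gridPoint M w) : Fin n → ℝ) = A j (gridPoint M w) := by
    intro w hw
    refine hA j _ (interior_subset (hstar _ fun i => ?_))
    have h1 := abs_le.1 (hw i)
    have h2 := hv i
    rw [mul_gridPoint_apply hM (by omega) (by omega)]
    exact_mod_cast hw i
  have hs : ∀ i, |(Pi.single i₀ 1 : Fin n → ℤ) i| ≤ 1 := fun i => by
    rcases eq_or_ne i i₀ with rfl | hi
    · simp
    · simp [hi]
  rw [hfA v (by simp), hfA (v - Pi.single i₀ 1) (fun i => by simpa using hs i),
    hfA (v + Pi.single i₀ 1) (fun i => by simpa using hs i)]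
  have hsum : (gridPoint M v : Fin n → ℝ) + (gridPoint M v : Fin n → ℝ) =
      (gridPoint M (v - Pi.single i₀ 1) : Fin n → ℝ) +
        (gridPoint M (v + Pi.single i₀ 1) : Fin n → ℝ) := by
    ext i
    have h1 := abs_le.1 (hs i)
    have h2 := hv i
    rw [Pi.add_apply, Pi.add_apply, gridPoint_apply (by omega) (by omega),
      gridPoint_apply (by rw [Pi.sub_apply]; omega) (by rw [Pi.sub_apply]; omega),
      gridPoint_apply (by rw [Pi.add_apply]; omega) (by rw [Pi.add_apply]; omega), Pi.sub_apply,
      Pi.add_apply]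
    push_cast
    ring
  rw [AffineMap.decomp (A j)]
  simp only [Pi.add_apply]
  rw [add_add_add_comm, ← map_add (A j).linear, hsum, map_add, add_add_add_comm]

end Cube

/-- For every `n ≥ 1`, the group `PL(Iⁿ)` of orientation-preserving piecewise linear
homeomorphisms of the cube `[0,1]ⁿ` admits no Polish group topology: no topology making it
a separable completely metrizable topological group. -/
theorem plCube_no_polish_group_topology (n : ℕ) (hn : 1 ≤ n)
    (H : Subgroup (Homeomorph (Cube n) (Cube n)))
    (hH : (H : Set (Homeomorph (Cube n) (Cube n))) = {f | IsPLCubeHomeo f}) :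
    ¬ ∃ τ : TopologicalSpace H, @IsTopologicalGroup H τ _ ∧ @PolishSpace H τ := by
  rintro ⟨τ, hG, hP⟩
  let _ : MeasurableSpace H := borel H
  have : BorelSpace H := ⟨rfl⟩
  let i₀ : Fin n := ⟨0, hn⟩
  have hmem : ∀ f, f ∈ H ↔ IsPLCubeHomeo f := fun f => by
    rw [← SetLike.mem_coe, hH, mem_ofPred_eq]
  let ι := {q : ℕ × (Fin n → ℤ) // 0 < q.1 ∧ ∀ i, 1 ≤ q.2 i ∧ q.2 i + 1 ≤ q.1}
  let B : ι → Set H := fun q =>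
    {f | ((f : Homeomorph (Cube n) (Cube n)) (gridPoint q.1.1 q.1.2) : Fin n → ℝ) +
      (f : Homeomorph (Cube n) (Cube n)) (gridPoint q.1.1 q.1.2) =
      ((f : Homeomorph (Cube n) (Cube n)) (gridPoint q.1.1 (q.1.2 - Pi.single i₀ 1)) :
        Fin n → ℝ) + (f : Homeomorph (Cube n) (Cube n))
          (gridPoint q.1.1 (q.1.2 + Pi.single i₀ 1))}
  have hmeas : ∀ x : Cube n, Measurable fun f : H =>
      ((f : Homeomorph (Cube n) (Cube n)) x : Fin n → ℝ) := fun x =>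
    measurable_subtype_coe.comp (measurable_apply_of_isPLCubeHomeo i₀ hH x)
  have hB : ∀ q, BaireMeasurableSet (B q) := fun q =>
    (measurableSet_eq_fun ((hmeas _).add (hmeas _))
      ((hmeas _).add (hmeas _))).baireMeasurableSet
  have hcov : ⋃ q, B q = univ := eq_univ_of_forall fun f => by
    obtain ⟨M, v, hMv, hf⟩ := ((hmem f).1 f.2).exists_midpoint i₀
    exact mem_iUnion.2 ⟨⟨(M, v), hMv⟩, hf⟩
  have hex : ∀ (q : ι) (a : ℝ), ∃ h : H, a ∈ Ioo (0 : ℝ) (1 / (2 * q.1.1)) →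
      ∀ x : Cube n, ((h : Homeomorph (Cube n) (Cube n)) x : Fin n → ℝ) = (x : Fin n → ℝ) +
        Pi.single i₀ (a * kuhnHat fun i => q.1.1 * (x : Fin n → ℝ) i - q.1.2 i) := by
    intro q a
    by_cases ha : a ∈ Ioo (0 : ℝ) (1 / (2 * q.1.1))
    · obtain ⟨f, hf, hfx⟩ := exists_isPLCubeHomeo_kuhnHat i₀ q.1.2 (q.2.2 i₀).1 (q.2.2 i₀).2
        ha.1 ha.2
      exact ⟨⟨f, (hmem f).2 hf⟩, fun _ => hfx⟩
    · exact ⟨1, fun h => absurd h ha⟩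
  choose h hh using hex
  obtain ⟨q, hq⟩ := exists_countable_of_pairwiseDisjoint_translates B hB hcov
    (fun q => Ioo (0 : ℝ) (1 / (2 * q.1.1))) h (by
      rintro ⟨⟨M, v⟩, hM, hv⟩ a ha b hb hab f hfa hfb
      simp only at hM hv ha hb
      have hfix : ∀ c ∈ Ioo (0 : ℝ) (1 / (2 * M)), ∀ w : Fin n → ℤ, (∀ i, 0 ≤ w i ∧ w i ≤ M) →
          |w i₀ - v i₀| = 1 →
          (h ⟨(M, v), hM, hv⟩ c : Homeomorph (Cube n) (Cube n)) (gridPoint M w) =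
            gridPoint M w := by
        intro c hc w hw hwv
        refine Subtype.ext ?_
        rw [hh ⟨(M, v), hM, hv⟩ c hc, kuhnHat_eq_zero (i := i₀)]
        · simp
        · rw [mul_gridPoint_apply hM (hw i₀).1 (hw i₀).2]
          exact_mod_cast hwv.ge
      have hs : ∀ i, |(Pi.single i₀ 1 : Fin n → ℤ) i| ≤ 1 := fun i => by
        rcases eq_or_ne i i₀ with rfl | hi
        · simp
        · simp [hi]
      have hsub : ∀ i, 0 ≤ (v - Pi.single i₀ 1 : Fin n → ℤ) i ∧
          (v - Pi.single i₀ 1 : Fin n → ℤ) i ≤ M := fun i => by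
        have h1 := abs_le.1 (hs i)
        have h2 := hv i
        rw [Pi.sub_apply]
        omega
      have hadd : ∀ i, 0 ≤ (v + Pi.single i₀ 1 : Fin n → ℤ) i ∧
          (v + Pi.single i₀ 1 : Fin n → ℤ) i ≤ M := fun i => by
        have h1 := abs_le.1 (hs i)
        have h2 := hv i
        rw [Pi.add_apply]
        omega
      have hmid : ∀ c ∈ Ioo (0 : ℝ) (1 / (2 * M)), f * h ⟨(M, v), hM, hv⟩ c ∈ B ⟨(M, v), hM, hv⟩ →
          ((f : Homeomorph (Cube n) (Cube n)) ((h ⟨(M, v), hM, hv⟩ c :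
            Homeomorph (Cube n) (Cube n)) (gridPoint M v)) : Fin n → ℝ) +
          (f : Homeomorph (Cube n) (Cube n)) ((h ⟨(M, v), hM, hv⟩ c :
            Homeomorph (Cube n) (Cube n)) (gridPoint M v)) =
          ((f : Homeomorph (Cube n) (Cube n)) (gridPoint M (v - Pi.single i₀ 1)) : Fin n → ℝ) +
            (f : Homeomorph (Cube n) (Cube n)) (gridPoint M (v + Pi.single i₀ 1)) := by
        intro c hc hfc
        have h1 := hfix c hc (v - Pi.single i₀ 1) hsub (by simp)
        have h2 := hfix c hc (v + Pi.single i₀ 1) hadd (by simp)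
        exact Eq.trans hfc (congrArg₂ (fun s t : Cube n =>
          ((f : Homeomorph (Cube n) (Cube n)) s : Fin n → ℝ) +
            (f : Homeomorph (Cube n) (Cube n)) t) h1 h2)
      have hdouble := (hmid a ha hfa).trans (hmid b hb hfb).symm
      have hval : (h ⟨(M, v), hM, hv⟩ a : Homeomorph (Cube n) (Cube n)) (gridPoint M v) =
          (h ⟨(M, v), hM, hv⟩ b : Homeomorph (Cube n) (Cube n)) (gridPoint M v) := by
        refine (f : Homeomorph (Cube n) (Cube n)).injective (Subtype.ext (funext fun i => ?_))
        have := congrFun hdouble i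
        simp only [Pi.add_apply] at this
        linarith
      have hgrid : (fun i => (M : ℝ) * (gridPoint M v : Fin n → ℝ) i - v i) = 0 :=
        funext fun i => by
          have := hv i
          rw [mul_gridPoint_apply hM (by omega) (by omega), sub_self, Pi.zero_apply]
      have hval' := congrFun (congrArg Subtype.val hval) i₀
      rw [hh ⟨(M, v), hM, hv⟩ a ha, hh ⟨(M, v), hM, hv⟩ b hb] at hval'
      simp only [hgrid, kuhnHat_zero, Pi.add_apply, Pi.single_eq_same, mul_one] at hval'
      exact hab (add_left_cancel hval'))
  have hpos : (0 : ℝ) < 1 / (2 * q.1.1) := by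
    have : (0 : ℝ) < q.1.1 := by exact_mod_cast q.2.1
    positivity
  rw [← Cardinal.le_aleph0_iff_set_countable, Cardinal.mk_Ioo_real hpos] at hq
  exact absurd hq (not_le.2 Cardinal.aleph0_lt_continuum)
end

section
/- For every n ≥ 1, the group PL(Iⁿ, ∂) of orientation-preserving piecewise linear homeomorphisms of [0,1]ⁿ that fix the boundary of the cube pointwise admits no Polish group topology: there is no topology on PL(Iⁿ, ∂) making it a topological group that is separable and completely metrizable. -/
section Simplex

variable {ι E : Type*} [NormedAddCommGroup E] [NormedSpace ℝ E]

/-- Barycentric coordinates write an affine functional as a combination of its vertex values. -/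
theorem AffineBasis.sum_coord_mul_apply [Fintype ι] (b : AffineBasis ι ℝ E) (f : E →ᵃ[ℝ] ℝ)
    (x : E) : f x = ∑ i, b.coord i x * f (b i) := by
  conv_lhs => rw [← b.affineCombination_coord_eq_self x]
  rw [Finset.map_affineCombination _ _ _ (b.sum_coord_apply_eq_one x),
    Finset.affineCombination_eq_linear_combination _ _ _ (b.sum_coord_apply_eq_one x)]
  simp

theorem AffineBasis.mem_convexHull_iff (b : AffineBasis ι ℝ E) {x : E} :
    x ∈ convexHull ℝ (Set.range b) ↔ ∀ j, 0 ≤ b.coord j x := by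
  rw [b.convexHull_eq_nonneg_coord]; rfl

theorem AffineBasis.mem_interior_convexHull_iff [Finite ι] (b : AffineBasis ι ℝ E) {x : E} :
    x ∈ interior (convexHull ℝ (Set.range b)) ↔ ∀ j, 0 < b.coord j x := by
  rw [b.interior_convexHull]; rfl

theorem AffineBasis.subset_closure_interior_convexHull [FiniteDimensional ℝ E]
    (b : AffineBasis ι ℝ E) :
    convexHull ℝ (Set.range b) ⊆ closure (interior (convexHull ℝ (Set.range b))) := by
  rw [(convex_convexHull ℝ _).closure_interior_eq_closure_of_nonempty_interior]
  · exact subset_closure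
  · rw [interior_convexHull_nonempty_iff_affineSpan_eq_top]
    exact b.tot

theorem AffineBasis.affineIndependent_update [DecidableEq ι] (b : AffineBasis ι ℝ E) {i : ι} {q : E}
    (hq : b.coord i q ≠ 0) : AffineIndependent ℝ (Function.update b i q) := by
  apply b.ind.affineIndependent_update_of_notMem_affineSpan
  intro hmem
  apply hq
  have hle : affineSpan ℝ (b '' {x | x ≠ i}) ≤
      (affineSpan ℝ {(0 : ℝ)}).comap (b.coord i) := by
    rw [affineSpan_le]
    rintro _ ⟨j, hj, rfl⟩
    simp [b.coord_apply_ne (Ne.symm hj)]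
  simpa using hle hmem

end Simplex

section Replace

variable {ι E : Type*} [Fintype ι] [DecidableEq ι] [NormedAddCommGroup E] [NormedSpace ℝ E]
  [FiniteDimensional ℝ E]

/-- The affine basis obtained from `b` by replacing the vertex `b i` by a point `q` whose `i`-th
barycentric coordinate does not vanish. -/
noncomputable def AffineBasis.replace (b : AffineBasis ι ℝ E) (i : ι) (q : E)
    (hq : b.coord i q ≠ 0) : AffineBasis ι ℝ E where
  toFun := Function.update b i q
  ind' := b.affineIndependent_update hq
  tot' := by
    rw [(b.affineIndependent_update hq).affineSpan_eq_top_iff_card_eq_finrank_add_one]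
    exact b.card_eq_finrank_add_one

variable (b : AffineBasis ι ℝ E) {i : ι} {q : E}

@[simp] theorem AffineBasis.replace_self (hq : b.coord i q ≠ 0) : b.replace i q hq i = q :=
  Function.update_self (β := fun _ => E) i q b

theorem AffineBasis.replace_of_ne (hq : b.coord i q ≠ 0) {j : ι} (hj : j ≠ i) :
    b.replace i q hq j = b j :=
  Function.update_of_ne (β := fun _ => E) hj q b

theorem AffineBasis.coord_replace_self (hq : b.coord i q ≠ 0) (x : E) :
    (b.replace i q hq).coord i x = b.coord i x / b.coord i q := by
  have h := (b.replace i q hq).sum_coord_mul_apply (b.coord i) x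
  rw [Finset.sum_eq_single i] at h
  · rw [h]; simp [hq]
  · intro j _ hj
    rw [b.replace_of_ne hq hj, b.coord_apply_ne hj.symm, mul_zero]
  · simp

theorem AffineBasis.coord_replace_of_ne (hq : b.coord i q ≠ 0) {j : ι} (hj : j ≠ i)
    (x : E) :
    (b.replace i q hq).coord j x = b.coord j x - b.coord i x / b.coord i q * b.coord j q := by
  have h := (b.replace i q hq).sum_coord_mul_apply (b.coord j) x
  rw [Fintype.sum_eq_add i j hj.symm] at h
  · rw [h, b.coord_replace_self, b.replace_self, b.replace_of_ne hq hj, b.coord_apply_eq]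
    ring
  · rintro k ⟨hk, hkj⟩
    rw [b.replace_of_ne hq hk, b.coord_apply_ne hkj.symm, mul_zero]

theorem AffineBasis.replace_pos_mem (hq : ∀ j, 0 < b.coord j q) {x : E} :
    x ∈ convexHull ℝ (Set.range (b.replace i q (hq i).ne')) ↔
      0 ≤ b.coord i x ∧ ∀ j, b.coord i x / b.coord i q ≤ b.coord j x / b.coord j q := by
  rw [AffineBasis.mem_convexHull_iff]
  constructor
  · intro h
    constructor
    · have := h i
      rw [b.coord_replace_self] at this
      by_contra hlt
      exact absurd this (not_le.2 (div_neg_of_neg_of_pos (not_le.1 hlt) (hq i)))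
    · intro j
      by_cases hj : j = i
      · rw [hj]
      · have := h j
        rw [b.coord_replace_of_ne _ hj] at this
        rw [le_div_iff₀ (hq j)]; linarith
  · rintro ⟨h0, h⟩ j
    by_cases hj : j = i
    · rw [hj, b.coord_replace_self]
      exact div_nonneg h0 (hq i).le
    · rw [b.coord_replace_of_ne _ hj]
      have := h j
      rw [le_div_iff₀ (hq j)] at this; linarith

theorem AffineBasis.iUnion_convexHull_replace [Nonempty ι] (hq : ∀ j, 0 < b.coord j q) :
    ⋃ i, convexHull ℝ (Set.range (b.replace i q (hq i).ne')) = convexHull ℝ (Set.range b) := by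
  ext x
  simp only [Set.mem_iUnion, b.replace_pos_mem hq, b.mem_convexHull_iff]
  constructor
  · rintro ⟨i, h0, h⟩ j
    have h1 := (div_nonneg h0 (hq i).le).trans (h j)
    have h2 := mul_nonneg h1 (hq j).le
    rwa [div_mul_cancel₀ _ (hq j).ne'] at h2
  · intro h
    obtain ⟨i, hi⟩ := Finite.exists_min fun j => b.coord j x / b.coord j q
    exact ⟨i, h i, hi⟩

theorem AffineBasis.disjoint_interior_replace (hq : ∀ j, 0 < b.coord j q) {i j : ι}
    (hij : i ≠ j) :
    interior (convexHull ℝ (Set.range (b.replace i q (hq i).ne'))) ∩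
      interior (convexHull ℝ (Set.range (b.replace j q (hq j).ne'))) = ∅ := by
  ext x
  simp only [Set.mem_inter_iff, AffineBasis.mem_interior_convexHull_iff, Set.mem_empty_iff_false,
    iff_false]
  rintro ⟨h1, h2⟩
  have h3 := h1 j
  have h4 := h2 i
  rw [b.coord_replace_of_ne _ hij.symm] at h3
  rw [b.coord_replace_of_ne _ hij] at h4
  have h5 : b.coord i x / b.coord i q < b.coord j x / b.coord j q := by
    rw [lt_div_iff₀ (hq j)]; linarith
  have h6 : b.coord j x / b.coord j q < b.coord i x / b.coord i q := by
    rw [lt_div_iff₀ (hq i)]; linarith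
  exact lt_asymm h5 h6

end Replace

/-- A family of `n`-simplices tiling the cube: the interiors are pairwise disjoint and the union
is the whole cube. -/
def IsCubeTiling {n : ℕ} {κ : Type} (b : κ → AffineBasis (Fin (n + 1)) ℝ (Fin n → ℝ)) : Prop :=
  (∀ i j, i ≠ j → interior (convexHull ℝ (Set.range (b i))) ∩
    interior (convexHull ℝ (Set.range (b j))) = ∅) ∧
  (⋃ i, convexHull ℝ (Set.range (b i))) = Set.Icc (0 : Fin n → ℝ) 1

section Tiling

variable {n : ℕ} {κ : Type} {b : κ → AffineBasis (Fin (n + 1)) ℝ (Fin n → ℝ)}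

/-- Starring one simplex of a tiling at an interior point gives a tiling. -/
theorem IsCubeTiling.star (hb : IsCubeTiling b) (c : κ) {q : Fin n → ℝ}
    (hq : ∀ j, 0 < (b c).coord j q) :
    IsCubeTiling (Sum.elim (fun d : {d // d ≠ c} => b d)
      (fun i => (b c).replace i q ((hq i).ne'))) := by
  have hsub : ∀ i, convexHull ℝ (Set.range ((b c).replace i q (hq i).ne')) ⊆
      convexHull ℝ (Set.range (b c)) := fun i => by
    rw [← (b c).iUnion_convexHull_replace hq]
    exact Set.subset_iUnion (fun i => convexHull ℝ (Set.range ((b c).replace i q (hq i).ne'))) i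
  constructor
  · rintro (d | i) (e | j) hne
    · exact hb.1 d e fun h => hne (by rw [Subtype.ext h])
    · refine Set.subset_eq_empty ?_ (hb.1 d c d.2)
      exact Set.inter_subset_inter_right _ (interior_mono (hsub j))
    · refine Set.subset_eq_empty ?_ (hb.1 c e e.2.symm)
      exact Set.inter_subset_inter_left _ (interior_mono (hsub i))
    · exact (b c).disjoint_interior_replace hq fun h => hne (by rw [h])
  · rw [Set.iUnion_sum]
    simp only [Sum.elim_inl, Sum.elim_inr]
    rw [(b c).iUnion_convexHull_replace hq, ← hb.2]
    ext x
    simp only [Set.mem_union, Set.mem_iUnion]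
    constructor
    · rintro (⟨d, hd⟩ | h)
      exacts [⟨d, hd⟩, ⟨c, h⟩]
    · rintro ⟨d, hd⟩
      by_cases hdc : d = c
      · exact Or.inr (hdc ▸ hd)
      · exact Or.inl ⟨⟨d, hdc⟩, hd⟩

/-- If the cube has a finite tiling, then it has finite tilings with a simplex inside any given
convex open set meeting the cube. -/
theorem IsCubeTiling.exists_subset [Finite κ] (hb : IsCubeTiling b) {V : Set (Fin n → ℝ)}
    (hV : IsOpen V) (hc : Convex ℝ V) (hne : (V ∩ Set.Icc 0 1).Nonempty) :
    ∃ (κ' : Type) (_ : Finite κ') (b' : κ' → AffineBasis (Fin (n + 1)) ℝ (Fin n → ℝ)) (c : κ'),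
      IsCubeTiling b' ∧ convexHull ℝ (Set.range (b' c)) ⊆ V := by
  suffices h : ∀ m : ℕ, ∃ (κ' : Type) (_ : Finite κ')
      (b' : κ' → AffineBasis (Fin (n + 1)) ℝ (Fin n → ℝ)) (c : κ'),
      IsCubeTiling b' ∧ (V ∩ interior (convexHull ℝ (Set.range (b' c)))).Nonempty ∧
        ∀ j : Fin (n + 1), (j : ℕ) < m → b' c j ∈ V by
    obtain ⟨κ', hκ', b', c, hb', -, hm⟩ := h (n + 1)
    refine ⟨κ', hκ', b', c, hb', convexHull_min ?_ hc⟩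
    rintro _ ⟨j, rfl⟩
    exact hm j j.2
  intro m
  induction m with
  | zero =>
    obtain ⟨x, hxV, hx⟩ := hne
    rw [← hb.2, Set.mem_iUnion] at hx
    obtain ⟨c, hx⟩ := hx
    refine ⟨κ, inferInstance, b, c, hb, ?_, by simp⟩
    exact mem_closure_iff.1 ((b c).subset_closure_interior_convexHull hx) V hV hxV
  | succ m ih =>
    obtain ⟨κ', hκ', b', c, hb', ⟨q, hqV, hq⟩, hm⟩ := ih
    by_cases hmn : m < n + 1
    · rw [AffineBasis.mem_interior_convexHull_iff] at hq
      refine ⟨_, inferInstance, _, Sum.inr ⟨m, hmn⟩, hb'.star c hq, ?_, ?_⟩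
      · refine mem_closure_iff.1 (AffineBasis.subset_closure_interior_convexHull _
          (subset_convexHull ℝ _
            ⟨⟨m, hmn⟩, (b' c).replace_self (hq ⟨m, hmn⟩).ne'⟩)) V hV hqV
      · intro j hj
        simp only [Sum.elim_inr]
        by_cases hjm : j = ⟨m, hmn⟩
        · rw [hjm, AffineBasis.replace_self]
          exact hqV
        · rw [AffineBasis.replace_of_ne _ _ hjm]
          refine hm j ?_
          have : (j : ℕ) ≠ m := fun h => hjm (Fin.ext h)
          omega
    · exact ⟨κ', hκ', b', c, hb', ⟨q, hqV, hq⟩, fun j _ => hm j (by omega)⟩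

end Tiling

section Push

variable {n : ℕ}

/-- The function on `ℝⁿ` that is affine on each simplex spanned by `q` and a facet of the simplex
`b`, equal to `1` at `q` and to `0` on the boundary of the simplex. -/
noncomputable def AffineBasis.tent (b : AffineBasis (Fin (n + 1)) ℝ (Fin n → ℝ))
    (q x : Fin n → ℝ) : ℝ :=
  Finset.univ.inf' Finset.univ_nonempty fun i => b.coord i x / b.coord i q

/-- The map supported in the simplex `b` that sends the point `q` to `q'`, and is affine on each
simplex spanned by `q` and a facet of the simplex `b`. -/
noncomputable def AffineBasis.push (b : AffineBasis (Fin (n + 1)) ℝ (Fin n → ℝ))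
    (q q' x : Fin n → ℝ) : Fin n → ℝ :=
  x + max 0 (b.tent q x) • (q' - q)

variable (b : AffineBasis (Fin (n + 1)) ℝ (Fin n → ℝ)) {q q' x : Fin n → ℝ}

theorem AffineBasis.tent_le (i : Fin (n + 1)) : b.tent q x ≤ b.coord i x / b.coord i q :=
  Finset.inf'_le _ (Finset.mem_univ i)

theorem AffineBasis.exists_tent_eq (q x : Fin n → ℝ) :
    ∃ i, b.tent q x = b.coord i x / b.coord i q := by
  obtain ⟨i, -, hi⟩ := Finset.exists_mem_eq_inf' Finset.univ_nonempty
    fun i => b.coord i x / b.coord i q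
  exact ⟨i, hi⟩

theorem AffineBasis.continuous_tent (q : Fin n → ℝ) : Continuous (b.tent q) := by
  unfold AffineBasis.tent
  refine Continuous.finset_inf'_apply _ fun i _ => ?_
  exact (AffineMap.continuous_of_finiteDimensional _).div_const _

theorem AffineBasis.continuous_push (q q' : Fin n → ℝ) : Continuous (b.push q q') := by
  have := b.continuous_tent q
  unfold AffineBasis.push
  fun_prop

theorem AffineBasis.tent_pos_iff (hq : ∀ j, 0 < b.coord j q) :
    0 < b.tent q x ↔ x ∈ interior (convexHull ℝ (Set.range b)) := by
  rw [b.mem_interior_convexHull_iff]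
  constructor
  · intro h j
    exact (div_pos_iff_of_pos_right (hq j)).1 (h.trans_le (b.tent_le j))
  · intro h
    obtain ⟨i, hi⟩ := b.exists_tent_eq q x
    rw [hi]
    exact div_pos (h i) (hq i)

theorem AffineBasis.coord_add_smul (i : Fin (n + 1)) (c : ℝ) :
    b.coord i (x + c • (q' - q)) = b.coord i x + c * (b.coord i q' - b.coord i q) := by
  have h1 := (b.coord i).map_vadd x (c • (q' - q))
  have h2 := (b.coord i).linearMap_vsub q' q
  simp only [vadd_eq_add, vsub_eq_sub, map_smul, smul_eq_mul] at h1 h2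
  rw [add_comm x, h1, h2, add_comm]

theorem AffineBasis.push_of_notMem (hq : ∀ j, 0 < b.coord j q)
    (hx : x ∉ interior (convexHull ℝ (Set.range b))) : b.push q q' x = x := by
  rw [← b.tent_pos_iff hq, not_lt] at hx
  simp [AffineBasis.push, max_eq_left hx]

theorem AffineBasis.push_mem (hq : ∀ j, 0 < b.coord j q) (hq' : ∀ j, 0 < b.coord j q')
    (hx : x ∈ interior (convexHull ℝ (Set.range b))) :
    b.push q q' x ∈ interior (convexHull ℝ (Set.range b)) := by
  rw [← b.tent_pos_iff hq] at hx
  rw [b.mem_interior_convexHull_iff]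
  intro j
  rw [AffineBasis.push, max_eq_right hx.le, b.coord_add_smul]
  have h1 := (le_div_iff₀ (hq j)).1 (b.tent_le (q := q) (x := x) j)
  have h2 := mul_pos hx (hq' j)
  linarith

theorem AffineBasis.tent_push (hq : ∀ j, 0 < b.coord j q) (hq' : ∀ j, 0 < b.coord j q') :
    max 0 (b.tent q' (b.push q q' x)) = max 0 (b.tent q x) := by
  by_cases hx : x ∈ interior (convexHull ℝ (Set.range b))
  · have hx' := (b.tent_pos_iff hq).2 hx
    congr 1
    have hc : ∀ j, b.coord j (b.push q q' x) =
        b.coord j x + b.tent q x * (b.coord j q' - b.coord j q) := fun j => by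
      rw [AffineBasis.push, max_eq_right hx'.le, b.coord_add_smul]
    apply le_antisymm
    · obtain ⟨i, hi⟩ := b.exists_tent_eq q x
      refine (b.tent_le i).trans ?_
      rw [div_le_iff₀ (hq' i), hc]
      have h1 := (eq_div_iff (hq i).ne').1 hi
      linarith
    · obtain ⟨i, hi⟩ := b.exists_tent_eq q' (b.push q q' x)
      rw [hi, le_div_iff₀ (hq' i), hc]
      have h1 := (le_div_iff₀ (hq i)).1 (b.tent_le (q := q) (x := x) i)
      linarith
  · rw [b.push_of_notMem hq hx]
    rw [max_eq_left, max_eq_left]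
    · rwa [← b.tent_pos_iff hq, not_lt] at hx
    · rwa [← b.tent_pos_iff hq', not_lt] at hx

theorem AffineBasis.push_push (hq : ∀ j, 0 < b.coord j q) (hq' : ∀ j, 0 < b.coord j q') :
    b.push q' q (b.push q q' x) = x := by
  rw [AffineBasis.push, b.tent_push hq hq', AffineBasis.push, add_assoc, ← smul_add]
  simp

theorem AffineBasis.push_self (hq : ∀ j, 0 < b.coord j q) : b.push q q' q = q' := by
  obtain ⟨i, hi⟩ := b.exists_tent_eq q q
  rw [div_self (hq i).ne'] at hi
  simp [AffineBasis.push, hi]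

theorem AffineBasis.push_mem_of_subset {S : Set (Fin n → ℝ)}
    (hS : convexHull ℝ (Set.range b) ⊆ S) (hq : ∀ j, 0 < b.coord j q)
    (hq' : ∀ j, 0 < b.coord j q') (hx : x ∈ S) : b.push q q' x ∈ S := by
  by_cases h : x ∈ interior (convexHull ℝ (Set.range b))
  · exact hS (interior_subset (b.push_mem hq hq' h))
  · rwa [b.push_of_notMem hq h]

/-- The homeomorphism of the cube induced by `AffineBasis.push`. -/
noncomputable def AffineBasis.pushHomeo (hb : convexHull ℝ (Set.range b) ⊆ Set.Icc 0 1)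
    (hq : ∀ j, 0 < b.coord j q) (hq' : ∀ j, 0 < b.coord j q') :
    Homeomorph (Cube n) (Cube n) where
  toFun x := ⟨b.push q q' x, b.push_mem_of_subset hb hq hq' x.2⟩
  invFun x := ⟨b.push q' q x, b.push_mem_of_subset hb hq' hq x.2⟩
  left_inv _ := Subtype.ext (b.push_push hq hq')
  right_inv _ := Subtype.ext (b.push_push hq' hq)
  continuous_toFun := ((b.continuous_push q q').comp continuous_subtype_val).subtype_mk _
  continuous_invFun := ((b.continuous_push q' q).comp continuous_subtype_val).subtype_mk _

/-- The affine map which agrees with `b.push q q'` on the simplex spanned by `q` and the facet of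
`b` opposite to the vertex `b i`. -/
noncomputable def AffineBasis.pushPiece (q q' : Fin n → ℝ) (i : Fin (n + 1)) :
    (Fin n → ℝ) →ᵃ[ℝ] (Fin n → ℝ) :=
  AffineMap.id ℝ (Fin n → ℝ) +
    (LinearMap.toSpanSingleton ℝ (Fin n → ℝ) (q' - q)).toAffineMap.comp
      ((b.coord i q)⁻¹ • b.coord i)

theorem AffineBasis.det_pushPiece_pos (hq : ∀ j, 0 < b.coord j q)
    (hq' : ∀ j, 0 < b.coord j q') (i : Fin (n + 1)) :
    0 < LinearMap.det (b.pushPiece q q' i).linear := by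
  have h : (b.pushPiece q q' i).linear =
      LinearMap.transvection ((b.coord i q)⁻¹ • (b.coord i).linear) (q' - q) := by
    refine LinearMap.ext fun x => ?_
    rw [LinearMap.transvection.apply]
    rfl
  have h2 := (b.coord i).linearMap_vsub q' q
  simp only [vsub_eq_sub] at h2
  rw [h, LinearMap.transvection.det, LinearMap.smul_apply, h2, smul_eq_mul, mul_sub,
    inv_mul_cancel₀ (hq i).ne', add_sub_cancel]
  exact mul_pos (inv_pos.2 (hq i)) (hq' i)

theorem AffineBasis.push_eq_pushPiece (hq : ∀ j, 0 < b.coord j q) {i : Fin (n + 1)}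
    (hx : x ∈ convexHull ℝ (Set.range (b.replace i q (hq i).ne'))) :
    b.push q q' x = b.pushPiece q q' i x := by
  rw [b.replace_pos_mem hq] at hx
  have h : b.tent q x = b.coord i x / b.coord i q :=
    le_antisymm (b.tent_le i) (Finset.le_inf' _ _ fun j _ => hx.2 j)
  rw [AffineBasis.push, h, max_eq_right (div_nonneg hx.1 (hq i).le)]
  simp [AffineBasis.pushPiece, div_eq_inv_mul]

variable {b}

/-- A homeomorphism of the cube which is affine and orientation-preserving on each simplex of a
finite tiling is piecewise linear. -/
theorem IsCubeTiling.isPLCubeHomeo {κ : Type} [Finite κ]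
    {c : κ → AffineBasis (Fin (n + 1)) ℝ (Fin n → ℝ)} (hc : IsCubeTiling c)
    {f : Homeomorph (Cube n) (Cube n)} (A : κ → ((Fin n → ℝ) →ᵃ[ℝ] (Fin n → ℝ)))
    (hA : ∀ i, 0 < LinearMap.det (A i).linear)
    (hf : ∀ i, ∀ x : Cube n, (x : Fin n → ℝ) ∈ convexHull ℝ (Set.range (c i)) →
      (f x : Fin n → ℝ) = A i x) : IsPLCubeHomeo f := by
  let e := Finite.equivFin κ
  refine ⟨Nat.card κ, fun i => c (e.symm i), fun i => A (e.symm i), fun i => (c _).ind,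
    fun i j hij => hc.1 _ _ fun h => hij (e.symm.injective h), ?_, fun i => hA _,
    fun i => hf _⟩
  rw [← hc.2]
  exact e.symm.surjective.iUnion_comp fun i => convexHull ℝ (Set.range (c i))

theorem IsCubeTiling.isPLCubeHomeo_pushHomeo {κ : Type} [Finite κ]
    {c : κ → AffineBasis (Fin (n + 1)) ℝ (Fin n → ℝ)} (hc : IsCubeTiling c) (d : κ)
    (hb : convexHull ℝ (Set.range (c d)) ⊆ Set.Icc 0 1)
    (hq : ∀ j, 0 < (c d).coord j q) (hq' : ∀ j, 0 < (c d).coord j q') :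
    IsPLCubeHomeo ((c d).pushHomeo hb hq hq') := by
  refine (hc.star d hq).isPLCubeHomeo
    (Sum.elim (fun _ => AffineMap.id ℝ _) ((c d).pushPiece q q')) ?_ ?_
  · rintro (e | i)
    · simp
    · exact (c d).det_pushPiece_pos hq hq' i
  · rintro (e | i) x hx
    · refine (c d).push_of_notMem hq fun hxd => ?_
      obtain ⟨y, hy⟩ := mem_closure_iff.1 ((c e).subset_closure_interior_convexHull hx) _
        isOpen_interior hxd
      rw [hc.1 d e e.2.symm] at hy
      exact hy
    · exact (c d).push_eq_pushPiece hq hx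

/-- The identity being piecewise linear means that the cube has a finite tiling. -/
theorem IsPLCubeHomeo.exists_tiling {f : Homeomorph (Cube n) (Cube n)} (hf : IsPLCubeHomeo f) :
    ∃ (k : ℕ) (c : Fin k → AffineBasis (Fin (n + 1)) ℝ (Fin n → ℝ)), IsCubeTiling c := by
  obtain ⟨k, p, -, hp, hd, hu, -, -⟩ := hf
  refine ⟨k, fun i => ⟨p i, hp i, ?_⟩, hd, hu⟩
  rw [(hp i).affineSpan_eq_top_iff_card_eq_finrank_add_one]
  simp

end Push

section Supported

variable {X : Type*} [TopologicalSpace X]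

/-- The subgroup of `H` of those homeomorphisms that are the identity outside `U`. -/
def Subgroup.supportedIn (H : Subgroup (Homeomorph X X)) (U : Set X) : Subgroup H where
  carrier := {f | ∀ x ∉ U, f.1 x = x}
  one_mem' _ _ := rfl
  mul_mem' {f g} hf hg x hx := by
    change f.1 (g.1 x) = x
    rw [hg x hx, hf x hx]
  inv_mem' {f} hf x hx := by
    change f.1.symm x = x
    rw [Homeomorph.symm_apply_eq, hf x hx]

variable {H : Subgroup (Homeomorph X X)} {U V : Set X} {f g : H}

theorem Subgroup.supportedIn_mono (hUV : U ⊆ V) : H.supportedIn U ≤ H.supportedIn V :=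
  fun _ hf x hx => hf x fun h => hx (hUV h)

theorem Subgroup.apply_mem_of_mem_supportedIn (hf : f ∈ H.supportedIn U) {x : X} (hx : x ∈ U) :
    f.1 x ∈ U := by
  by_contra h
  have h1 := f.1.injective (hf _ h)
  rw [h1] at h
  exact h hx

theorem Subgroup.commute_of_disjoint (hUV : Disjoint U V) (hf : f ∈ H.supportedIn U)
    (hg : g ∈ H.supportedIn V) : Commute f g := by
  refine Subtype.ext (Homeomorph.ext fun x => ?_)
  change f.1 (g.1 x) = g.1 (f.1 x)
  by_cases hU : x ∈ U
  · rw [hg x (hUV.notMem_of_mem_left hU),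
      hg _ (hUV.notMem_of_mem_left (apply_mem_of_mem_supportedIn hf hU))]
  · rw [hf x hU]
    by_cases hV : x ∈ V
    · exact hf _ (hUV.notMem_of_mem_right (apply_mem_of_mem_supportedIn hg hV))
    · rw [hg x hV, hf x hU]

theorem Subgroup.exists_apply_ne (hf : f ≠ 1) (hfU : f ∈ H.supportedIn U) :
    ∃ x ∈ U, f.1 x ≠ x := by
  by_contra! h
  refine hf (Subtype.ext (Homeomorph.ext fun x => ?_))
  by_cases hx : x ∈ U
  exacts [h x hx, hfU x hx]

/-- If `H` contains nontrivial homeomorphisms supported in any nonempty open set, then an element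
of `H` commuting with all elements supported in `U` fixes `U` pointwise. -/
theorem Subgroup.apply_eq_of_commute [T2Space X]
    (hH : ∀ V : Set X, IsOpen V → V.Nonempty → ∃ s ∈ H.supportedIn V, s ≠ 1)
    (hU : IsOpen U) (hf : ∀ s ∈ H.supportedIn U, Commute f s) {x : X} (hx : x ∈ U) :
    f.1 x = x := by
  by_contra hne
  obtain ⟨A, B, hA, hB, hfA, hxB, hAB⟩ := t2_separation hne
  obtain ⟨s, hs, hs1⟩ := hH (U ∩ (B ∩ f.1 ⁻¹' A))
    (hU.inter (hB.inter (hA.preimage f.1.continuous))) ⟨x, hx, hxB, hfA⟩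
  obtain ⟨q, hq, hsq⟩ := exists_apply_ne hs1 hs
  have h1 : f.1 (s.1 q) = s.1 (f.1 q) :=
    congrArg (fun k : H => k.1 q) (hf s (supportedIn_mono Set.inter_subset_left hs)).eq
  rw [hs (f.1 q) fun h => hAB.notMem_of_mem_left hq.2.2 h.2.1] at h1
  exact hsq (f.1.injective h1)

end Supported

section PolishGroup

variable {G : Type*} [Group G] [TopologicalSpace G] [IsTopologicalGroup G]

/-- An uncountable subgroup of a second countable topological group accumulates at `1`. -/
theorem Subgroup.exists_mem_ne_one_of_uncountable [SecondCountableTopology G] (K : Subgroup G)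
    [Uncountable K] {W : Set G} (hW : W ∈ nhds 1) : ∃ g ∈ K, g ≠ 1 ∧ g ∈ W := by
  by_contra! h
  have hd : DiscreteTopology K := by
    apply discreteTopology_of_isOpen_singleton_one
    obtain ⟨O, hOW, hO, h1⟩ := mem_nhds_iff.1 hW
    refine ⟨O, hO, ?_⟩
    ext k
    constructor
    · intro hk
      by_contra hk1
      exact h k k.2 (fun h => hk1 (Subtype.ext h)) (hOW hk)
    · rintro rfl
      exact h1
  exact not_countable (TopologicalSpace.separableSpace_iff_countable.1
    (inferInstance : TopologicalSpace.SeparableSpace K))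

/-- In a Polish group, one can choose nontrivial elements of countably many uncountable subgroups
such that their infinite product converges. -/
theorem exists_tendsto_prod_of_uncountable [PolishSpace G] (K : ℕ → Subgroup G)
    [∀ i, Uncountable (K i)] :
    ∃ (g p : ℕ → G) (a : G), (∀ i, g i ∈ K i) ∧ (∀ i, g i ≠ 1) ∧ p 0 = 1 ∧
      (∀ i, p (i + 1) = p i * g i) ∧ Filter.Tendsto p Filter.atTop (nhds a) := by
  let _ := TopologicalSpace.upgradeIsCompletelyMetrizable G
  have step : ∀ (m : ℕ) (x : G), ∃ g ∈ K m, g ≠ 1 ∧ dist x (x * g) < 1 / 2 / 2 ^ m := by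
    intro m x
    refine (K m).exists_mem_ne_one_of_uncountable (W := {g | dist x (x * g) < 1 / 2 / 2 ^ m}) ?_
    refine IsOpen.mem_nhds ?_ ?_
    · exact isOpen_lt (continuous_const.dist (continuous_const.mul continuous_id))
        continuous_const
    · simp
  choose s hsK hs1 hsd using step
  let p : ℕ → G := fun m => Nat.rec 1 (fun m x => x * s m x) m
  obtain ⟨a, ha⟩ := cauchySeq_tendsto_of_complete
    (cauchySeq_of_le_geometric_two (f := p) (C := 1) fun m => (hsd m (p m)).le)
  exact ⟨fun m => s m (p m), p, a, fun m => hsK _ _, fun m => hs1 _ _, rfl, fun _ => rfl, ha⟩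

/-- Given pairwise commuting subgroups `L i` of a Polish group and uncountable subgroups
`K i ≤ L i`, there is an element which acts by conjugation on each `L i` as a nontrivial element
of `K i`. -/
theorem exists_forall_commute_of_uncountable [PolishSpace G] (K L : ℕ → Subgroup G)
    [∀ i, Uncountable (K i)] (hKL : ∀ i, K i ≤ L i)
    (hL : ∀ i j, i ≠ j → ∀ x ∈ L i, ∀ y ∈ L j, Commute x y) :
    ∃ a : G, ∀ i, ∃ g ∈ K i, g ≠ 1 ∧ ∀ s ∈ L i, Commute (g⁻¹ * a) s := by
  obtain ⟨g, p, a, hgK, hg1, hp0, hp, ha⟩ := exists_tendsto_prod_of_uncountable K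
  refine ⟨a, fun i => ⟨g i, hgK i, hg1 i, fun s hs => ?_⟩⟩
  have hlow : ∀ m ≤ i, ∀ t ∈ L i, Commute (p m) t := by
    intro m
    induction m with
    | zero => exact fun _ t _ => hp0 ▸ Commute.one_left t
    | succ m ih =>
      intro hm t ht
      rw [hp]
      exact (ih (by omega) t ht).mul_left (hL m i (by omega) _ (hKL m (hgK m)) t ht)
  have hhigh : ∀ m, Commute ((g i)⁻¹ * p (i + 1 + m)) s := by
    intro m
    induction m with
    | zero =>
      rw [Nat.add_zero, hp, (hlow i le_rfl _ (hKL i (hgK i))).eq, inv_mul_cancel_left]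
      exact hlow i le_rfl s hs
    | succ m ih =>
      rw [← Nat.add_assoc, hp, ← mul_assoc]
      exact ih.mul_left (hL _ i (by omega) _ (hKL _ (hgK _)) s hs)
  have hlim : Filter.Tendsto (fun m => (g i)⁻¹ * p (m + (i + 1))) Filter.atTop
      (nhds ((g i)⁻¹ * a)) :=
    ((Filter.tendsto_add_atTop_iff_nat (i + 1)).2 ha).const_mul _
  refine tendsto_nhds_unique (hlim.mul_const s) ((hlim.const_mul s).congr fun m => ?_)
  have := (hhigh m).eq
  rw [add_comm (i + 1) m] at this
  exact this.symm

end PolishGroup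

/-- If an affine map fixes two distinct points of the line through `x` and `y`, it fixes `x`. -/
theorem AffineMap.apply_left_eq_of_lineMap {E : Type*} [AddCommGroup E] [Module ℝ E]
    (A : E →ᵃ[ℝ] E) {x y : E} {s t : ℝ} (hst : s ≠ t)
    (hs : A (AffineMap.lineMap x y s) = AffineMap.lineMap x y s)
    (ht : A (AffineMap.lineMap x y t) = AffineMap.lineMap x y t) : A x = x := by
  rw [AffineMap.apply_lineMap, AffineMap.lineMap_apply_module, AffineMap.lineMap_apply_module]
    at hs ht
  have h : (t - s) • (A x - x) = 0 := by
    have h1 : (t - s) • (A x - x) = t • (((1 - s) • A x + s • A y) - ((1 - s) • x + s • y)) -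
        s • (((1 - t) • A x + t • A y) - ((1 - t) • x + t • y)) := by module
    rw [h1, hs, ht]
    simp
  rcases smul_eq_zero.1 h with h | h
  · exact absurd (sub_eq_zero.1 h).symm hst
  · exact sub_eq_zero.1 h

/-- A segment from a point inside a ball to a point outside it crosses the bounding sphere. -/
theorem exists_dist_lineMap_eq {E : Type*} [NormedAddCommGroup E] [NormedSpace ℝ E] {x y p : E}
    {r : ℝ} (hx : dist x p < r) (hy : r ≤ dist y p) :
    ∃ s ∈ Set.Icc (0 : ℝ) 1, dist (AffineMap.lineMap x y s) p = r := by
  have hc : Continuous fun s : ℝ => dist (AffineMap.lineMap x y s : E) p :=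
    AffineMap.lineMap_continuous.dist continuous_const
  have := intermediate_value_Icc (zero_le_one (α := ℝ)) hc.continuousOn
  simp only [AffineMap.lineMap_apply_zero, AffineMap.lineMap_apply_one] at this
  exact this ⟨hx.le, hy⟩

/-- A piecewise linear homeomorphism of the cube cannot move a point in each of infinitely many
disjoint balls while fixing the points near the boundary of each ball. -/
theorem IsPLCubeHomeo.exists_fixed {n : ℕ} {f : Homeomorph (Cube n) (Cube n)}
    (hf : IsPLCubeHomeo f) (p : ℕ → Cube n) (r : ℕ → ℝ) (hr : ∀ i, 0 < r i)
    (hd : ∀ i j, i ≠ j → Disjoint (Metric.ball (p i) (r i)) (Metric.ball (p j) (r j)))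
    (hfix : ∀ i, ∀ z ∈ Metric.ball (p i) (r i), z ∉ Metric.ball (p i) (r i / 2) → f z = z)
    (x : ℕ → Cube n) (hx : ∀ i, x i ∈ Metric.ball (p i) (r i / 2)) : ∃ i, f (x i) = x i := by
  obtain ⟨k, v, A, -, -, hu, -, hA⟩ := hf
  have hmem : ∀ i, ∃ j, (x i : Fin n → ℝ) ∈ convexHull ℝ (Set.range (v j)) := fun i => by
    rw [← Set.mem_iUnion, hu]
    exact (x i).2
  choose c hc using hmem
  obtain ⟨i, j, hij, hcij⟩ := Finite.exists_ne_map_eq_of_infinite c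
  have hout : ∀ a b, a ≠ b → r a / 2 ≤ dist (x b) (p a) := by
    intro a b hab
    by_contra! hlt
    refine Set.disjoint_left.1 (hd a b hab) (?_ : x b ∈ _) ?_
    · exact Metric.mem_ball.2 (hlt.trans (half_lt_self (hr a)))
    · exact Metric.ball_subset_ball (half_le_self (hr b).le) (hx b)
  have hseg : ∀ s ∈ Set.Icc (0 : ℝ) 1, (AffineMap.lineMap (x i : Fin n → ℝ) (x j) s) ∈
      convexHull ℝ (Set.range (v (c i))) := fun s hs =>
    (convex_convexHull ℝ _).lineMap_mem (hc i) (by rw [hcij]; exact hc j) hs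
  have hcross : ∀ a, ∀ s ∈ Set.Icc (0 : ℝ) 1,
      dist (AffineMap.lineMap (x i : Fin n → ℝ) (x j) s) (p a : Fin n → ℝ) = r a / 2 →
      ∃ z : Cube n, (z : Fin n → ℝ) = AffineMap.lineMap (x i : Fin n → ℝ) (x j) s ∧
        z ∈ Metric.ball (p a) (r a) ∧ A (c i) z = z := by
    intro a s hs hdist
    have hz : AffineMap.lineMap (x i : Fin n → ℝ) (x j) s ∈ Set.Icc (0 : Fin n → ℝ) 1 :=
      hu.subset (Set.mem_iUnion.2 ⟨_, hseg s hs⟩)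
    have hzb : (⟨_, hz⟩ : Cube n) ∈ Metric.ball (p a) (r a) := by
      rw [Metric.mem_ball, Subtype.dist_eq, hdist]
      exact half_lt_self (hr a)
    refine ⟨⟨_, hz⟩, rfl, hzb, ?_⟩
    rw [← hA (c i) ⟨_, hz⟩ (hseg s hs), hfix a _ hzb]
    rw [Metric.mem_ball, Subtype.dist_eq, hdist]
    exact lt_irrefl _
  obtain ⟨s, hs, hsd⟩ := exists_dist_lineMap_eq (x := (x i : Fin n → ℝ)) (y := x j)
    (p := p i) (hx i) (hout i j hij)
  obtain ⟨t, ht, htd⟩ := exists_dist_lineMap_eq (x := (x j : Fin n → ℝ)) (y := x i)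
    (p := p j) (hx j) (hout j i hij.symm)
  rw [← AffineMap.lineMap_apply_one_sub] at htd
  obtain ⟨z, hz, hzi, hzA⟩ := hcross i s hs hsd
  obtain ⟨w, hw, hwj, hwA⟩ := hcross j (1 - t)
    ⟨sub_nonneg.2 ht.2, sub_le_self _ ht.1⟩ htd
  refine ⟨i, Subtype.ext ?_⟩
  rw [hA (c i) (x i) (hc i)]
  refine (A (c i)).apply_left_eq_of_lineMap (s := s) (t := 1 - t) ?_ (hz ▸ hzA) (hw ▸ hwA)
  intro hst
  have hzw : z = w := Subtype.ext (by rw [hz, hw, hst])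
  exact Set.disjoint_left.1 (hd i j hij) hzi (hzw ▸ hwj)

/-- The group `PL(Iⁿ, ∂)` has uncountably many elements supported in any nonempty open set. -/
theorem uncountable_supportedIn {n : ℕ} (hn : 1 ≤ n)
    {H : Subgroup (Homeomorph (Cube n) (Cube n))}
    (hH : (H : Set (Homeomorph (Cube n) (Cube n))) =
      {f | IsPLCubeHomeo f ∧ ∀ x : Cube n,
        (x : Fin n → ℝ) ∈ frontier (Set.Icc (0 : Fin n → ℝ) 1) → f x = x})
    {U : Set (Cube n)} (hU : IsOpen U) (hne : U.Nonempty) : Uncountable (H.supportedIn U) := by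
  have h1 : (1 : Homeomorph (Cube n) (Cube n)) ∈ (H : Set (Homeomorph (Cube n) (Cube n))) :=
    H.one_mem
  rw [hH] at h1
  obtain ⟨k, c₀, hc₀⟩ := h1.1.exists_tiling
  obtain ⟨x, hx⟩ := hne
  obtain ⟨ε, hε, hball⟩ := Metric.isOpen_iff.1 hU x hx
  obtain ⟨κ, _, c, d, hc, hdV⟩ := hc₀.exists_subset (V := Metric.ball (x : Fin n → ℝ) ε)
    Metric.isOpen_ball (convex_ball _ _) ⟨x, Metric.mem_ball_self hε, x.2⟩
  have hcube : convexHull ℝ (Set.range (c d)) ⊆ Set.Icc 0 1 := by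
    rw [← hc.2]
    exact Set.subset_iUnion (fun d => convexHull ℝ (Set.range (c d))) d
  set S := interior (convexHull ℝ (Set.range (c d))) with hS
  have hSne : S.Nonempty := by
    rw [hS, interior_convexHull_nonempty_iff_affineSpan_eq_top]
    exact (c d).tot
  obtain ⟨q, hqS⟩ := hSne
  have hq := (c d).mem_interior_convexHull_iff.1 hqS
  have hpos : ∀ q' : S, ∀ j, 0 < (c d).coord j q' := fun q' =>
    (c d).mem_interior_convexHull_iff.1 q'.2
  have hmemH : ∀ q' : S, (c d).pushHomeo hcube hq (hpos q') ∈ H := by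
    intro q'
    rw [← SetLike.mem_coe, hH]
    refine ⟨hc.isPLCubeHomeo_pushHomeo d hcube hq (hpos q'), fun y hy => ?_⟩
    refine Subtype.ext ((c d).push_of_notMem hq fun hyS => ?_)
    exact hy.2 (interior_mono hcube hyS)
  have hmemU : ∀ q' : S, (⟨_, hmemH q'⟩ : H) ∈ H.supportedIn U := by
    intro q' y hy
    refine Subtype.ext ((c d).push_of_notMem hq fun hyS => hy (hball ?_))
    exact hdV (interior_subset hyS)
  have hinj : Function.Injective fun q' : S =>
      (⟨⟨_, hmemH q'⟩, hmemU q'⟩ : H.supportedIn U) := by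
    intro q₁ q₂ h
    have h2 : (c d).push q q₁ q = (c d).push q q₂ q :=
      congrArg (fun f : H.supportedIn U =>
        (f.1.1 ⟨q, hcube (interior_subset hqS)⟩ : Fin n → ℝ)) h
    rw [(c d).push_self hq, (c d).push_self hq] at h2
    exact Subtype.ext h2
  have hunc : Uncountable S := by
    have : Nonempty (Fin n) := ⟨⟨0, hn⟩⟩
    rw [← not_countable_iff]
    intro hcount
    obtain ⟨y, hy, hy'⟩ := ((Set.countable_coe_iff.1 hcount).dense_compl ℝ).inter_open_nonempty
      S isOpen_interior ⟨q, hqS⟩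
    exact hy' hy
  exact hinj.uncountable

/-- For every `n ≥ 1`, the group `PL(Iⁿ, ∂)` of orientation-preserving piecewise linear
homeomorphisms of the cube `[0,1]ⁿ` fixing its topological boundary pointwise admits no
Polish group topology: no topology making it a separable completely metrizable topological
group. -/
theorem plCubeBoundary_no_polish_group_topology (n : ℕ) (hn : 1 ≤ n)
    (H : Subgroup (Homeomorph (Cube n) (Cube n)))
    (hH : (H : Set (Homeomorph (Cube n) (Cube n))) =
      {f | IsPLCubeHomeo f ∧ ∀ x : Cube n,
        (x : Fin n → ℝ) ∈ frontier (Set.Icc (0 : Fin n → ℝ) 1) → f x = x}) :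
    ¬ ∃ τ : TopologicalSpace H, @IsTopologicalGroup H τ _ ∧ @PolishSpace H τ := by
  rintro ⟨τ, hτ, hP⟩
  have hunc : ∀ U : Set (Cube n), IsOpen U → U.Nonempty → Uncountable (H.supportedIn U) :=
    fun U hU hne => uncountable_supportedIn hn hH hU hne
  have hnontriv : ∀ U : Set (Cube n), IsOpen U → U.Nonempty →
      ∃ s ∈ H.supportedIn U, s ≠ 1 := by
    intro U hU hne
    have := hunc U hU hne
    obtain ⟨s, hs⟩ := exists_ne (1 : H.supportedIn U)
    exact ⟨s, s.2, fun h => hs (Subtype.ext h)⟩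
  have : Infinite (Cube n) := by
    have : Nonempty (Fin n) := ⟨⟨0, hn⟩⟩
    exact (Set.Icc_infinite (zero_lt_one (α := Fin n → ℝ))).to_subtype
  obtain ⟨W, hWinf, hWo, hWd⟩ := exists_seq_infinite_isOpen_pairwise_disjoint (X := Cube n)
  choose p hp using fun i => (hWinf i).nonempty
  choose r hr hball using fun i => Metric.isOpen_iff.1 (hWo i) (p i) (hp i)
  have hd : ∀ i j, i ≠ j → Disjoint (Metric.ball (p i) (r i)) (Metric.ball (p j) (r j)) :=
    fun i j hij => (hWd hij).mono (hball i) (hball j)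
  have : ∀ i, Uncountable (H.supportedIn (Metric.ball (p i) (r i / 2))) := fun i =>
    hunc _ Metric.isOpen_ball ⟨p i, Metric.mem_ball_self (half_pos (hr i))⟩
  have hsub : ∀ i, Metric.ball (p i) (r i / 2) ⊆ Metric.ball (p i) (r i) := fun i =>
    Metric.ball_subset_ball (half_le_self (hr i).le)
  obtain ⟨f, hf⟩ := exists_forall_commute_of_uncountable
    (fun i => H.supportedIn (Metric.ball (p i) (r i / 2)))
    (fun i => H.supportedIn (Metric.ball (p i) (r i)))
    (fun i => Subgroup.supportedIn_mono (hsub i))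
    fun i j hij x hx y hy => Subgroup.commute_of_disjoint (hd i j hij) hx hy
  choose g hgK hg1 hgf using hf
  have hfg : ∀ i, ∀ z ∈ Metric.ball (p i) (r i), f.1 z = (g i).1 z := by
    intro i z hz
    have h : (g i).1.symm (f.1 z) = z :=
      Subgroup.apply_eq_of_commute hnontriv Metric.isOpen_ball (hgf i) hz
    rwa [Homeomorph.symm_apply_eq] at h
  choose x hx hgx using fun i => Subgroup.exists_apply_ne (hg1 i) (hgK i)
  have hfPL : f.1 ∈ (H : Set (Homeomorph (Cube n) (Cube n))) := f.2
  rw [hH] at hfPL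
  obtain ⟨i, hi⟩ := hfPL.1.exists_fixed p r hr hd
    (fun i z hz hz' => (hfg i z hz).trans (hgK i z hz')) x hx
  exact hgx i ((hfg i _ (hsub i (hx i))).symm.trans hi)
end
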